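/- Let H = {K_r, C_{≥k}} with ⌊(k-1)/2⌋ + 2 ≤ r < k and n ≥ k ≥ 5. Then the maximum number of edges in an n-vertex 2-connected graph containing no K_r and no cycle of length at least k equals max{ g_r(n,2,k), g_r(n, ⌊(k-1)/2⌋, k) }, where g_r(n,a,k) = a(n-k+a) + ex(k-a, K_r). -/

import Mathlib

open SimpleGraph

/-- `exK n r` is the Turán number ex(n, K_r): the maximum number of edges of an
`n`-vertex graph containing no copy of `K_r`. -/
noncomputable def exK (n r : ℕ) : ℕ :=
  sSup {m | ∃ G : SimpleGraph (Fin n), G.CliqueFree r ∧ G.edgeSet.ncard = m}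

def TwoConnected {V : Type*} (G : SimpleGraph V) : Prop :=
  3 ≤ Nat.card V ∧ ∀ v : V, ((⊤ : G.Subgraph).deleteVerts {v}).coe.Connected

section PathOn

variable {V : Type*} [DecidableEq V] {G : SimpleGraph V}

/-- `PathOn G u v S` says that some path of `G` from `u` to `v` has vertex set exactly `S`. -/
def PathOn (G : SimpleGraph V) (u v : V) (S : Finset V) : Prop :=
  ∃ p : G.Walk u v, p.IsPath ∧ p.support.toFinset = S

theorem PathOn.refl (u : V) : PathOn G u u {u} := ⟨.nil, by simp, by simp⟩

theorem PathOn.symm {u v : V} {S : Finset V} (h : PathOn G u v S) : PathOn G v u S := by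
  obtain ⟨p, hp, rfl⟩ := h
  exact ⟨p.reverse, hp.reverse, by simp⟩

theorem PathOn.start_mem {u v : V} {S : Finset V} (h : PathOn G u v S) : u ∈ S := by
  obtain ⟨p, hp, rfl⟩ := h
  simp

theorem PathOn.end_mem {u v : V} {S : Finset V} (h : PathOn G u v S) : v ∈ S := h.symm.start_mem

theorem PathOn.of_adj {u v : V} (h : G.Adj u v) : PathOn G u v {u, v} :=
  ⟨.cons h .nil, by simp [h.ne], by ext; simp⟩

theorem PathOn.append {u v w : V} {S T : Finset V} (h₁ : PathOn G u v S) (h₂ : PathOn G v w T)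
    (h : ∀ x ∈ S, x ∈ T → x = v) : PathOn G u w (S ∪ T) := by
  obtain ⟨p, hp, rfl⟩ := h₁
  obtain ⟨q, hq, rfl⟩ := h₂
  refine ⟨p.append q, ?_, ?_⟩
  · rw [Walk.isPath_def, Walk.support_append, List.nodup_append']
    refine ⟨hp.support_nodup, hq.support_nodup.tail, ?_⟩
    intro x hx hx'
    have hxv := h x (by simpa using hx) (by simpa using List.mem_of_mem_tail hx')
    subst hxv
    have := hq.support_nodup
    rw [← Walk.cons_tail_support] at this
    exact (List.nodup_cons.mp this).1 hx'
  · ext x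
    simp [Walk.mem_support_append_iff]

theorem PathOn.split {u v w : V} {S : Finset V} (h : PathOn G u v S) (hw : w ∈ S) :
    ∃ A B, PathOn G u w A ∧ PathOn G w v B ∧ S = A ∪ B ∧ ∀ x ∈ A, x ∈ B → x = w := by
  obtain ⟨p, hp, rfl⟩ := h
  have hw : w ∈ p.support := by simpa using hw
  obtain ⟨q, r, hq, hr, rfl⟩ := hp.mem_support_iff_exists_append.mp hw
  refine ⟨_, _, ⟨q, hq, rfl⟩, ⟨r, hr, rfl⟩, ?_, ?_⟩
  · ext x
    simp [Walk.mem_support_append_iff]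
  · intro x hx hx'
    by_contra hne
    exact hp.ne_of_mem_support_of_append hne (by simpa using hx) (by simpa using hx') rfl

theorem exists_isCycle_of_pathOn {u v : V} {S T : Finset V} (h₁ : PathOn G u v S)
    (h₂ : PathOn G u v T) (h : ∀ x ∈ S, x ∈ T → x = u ∨ x = v) (huv : u ≠ v)
    (hc : 3 ≤ (S ∪ T).card) :
    ∃ (x : V) (C : G.Walk x x), C.IsCycle ∧ C.length = (S ∪ T).card := by
  obtain ⟨p, hp, rfl⟩ := h₁
  obtain ⟨q, hq, rfl⟩ := h₂.symm
  have hd : p.support.tail.Disjoint q.support.tail := by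
    intro x hx hx'
    have hp' := hp.support_nodup
    have hq' := hq.support_nodup
    rw [← Walk.cons_tail_support] at hp' hq'
    rcases h x (by simpa using List.mem_of_mem_tail hx)
      (by simpa using List.mem_of_mem_tail hx') with rfl | rfl
    · exact (List.nodup_cons.mp hp').1 hx
    · exact (List.nodup_cons.mp hq').1 hx'
  have hS : p.support.toFinset ∪ q.support.toFinset = (p.append q).support.tail.toFinset := by
    have hu : u ∈ q.support.tail := by
      exact (q.mem_support_iff.mp q.end_mem_support).resolve_left huv
    have hv : v ∈ p.support.tail := by
      exact (p.mem_support_iff.mp p.end_mem_support).resolve_left huv.symm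
    ext x
    rw [Walk.tail_support_append]
    simp only [Finset.mem_union, List.mem_toFinset, List.mem_append]
    rw [← Walk.cons_tail_support p, ← Walk.cons_tail_support q]
    simp only [List.mem_cons, List.tail_cons]
    grind
  have hlen : (p.append q).length = (p.support.toFinset ∪ q.support.toFinset).card := by
    rw [hS, List.toFinset_card_of_nodup]
    · simp
    · rw [Walk.tail_support_append, List.nodup_append']
      exact ⟨hp.support_nodup.tail, hq.support_nodup.tail, hd⟩
  have hl : p.length + q.length = (p.support.toFinset ∪ q.support.toFinset).card := by
    rw [← hlen, Walk.length_append]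
  exact ⟨u, p.append q, hp.isCycle_append hq hd (by omega), hlen⟩

theorem exists_isCycle_of_pathOn_adj {u v : V} {S : Finset V} (h : PathOn G u v S)
    (huv : G.Adj u v) (hc : 3 ≤ S.card) :
    ∃ (x : V) (C : G.Walk x x), C.IsCycle ∧ C.length = S.card := by
  have hS : S ∪ {u, v} = S := by
    have := h.start_mem
    have := h.end_mem
    grind
  have := exists_isCycle_of_pathOn h (PathOn.of_adj huv) (by simp) huv.ne (by rwa [hS])
  rwa [hS] at this

/-- A shortest path between two vertex sets meets each of them in one end only. -/
theorem PathOn.exists_bridge {S T : Finset V} {u v : V} {I : Finset V} (h : PathOn G u v I)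
    (hu : u ∈ S) (hv : v ∈ T) :
    ∃ u' ∈ S, ∃ v' ∈ T, ∃ J ⊆ I, PathOn G u' v' J ∧ (∀ x ∈ J, x ∈ S → x = u') ∧
      ∀ x ∈ J, x ∈ T → x = v' := by
  induction hn : I.card using Nat.strong_induction_on generalizing I u v with
  | _ n ih =>
  by_cases hS : ∀ x ∈ I, x ∈ S → x = u
  · by_cases hT : ∀ x ∈ I, x ∈ T → x = v
    · exact ⟨u, hu, v, hv, I, subset_rfl, h, hS, hT⟩
    · push Not at hT
      obtain ⟨x, hxI, hxT, hxv⟩ := hT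
      obtain ⟨A, B, hA, hB, rfl, hAB⟩ := h.split hxI
      have hlt : A.card < n := by
        rw [← hn]
        refine Finset.card_lt_card ⟨Finset.subset_union_left, fun hsub => ?_⟩
        have hvB := hB.end_mem
        exact hxv (hAB v (hsub (Finset.mem_union_right _ hvB)) hvB).symm
      obtain ⟨u', hu', v', hv', J, hJ, hr⟩ := ih _ hlt hA hu hxT rfl
      exact ⟨u', hu', v', hv', J, hJ.trans Finset.subset_union_left, hr⟩
  · push Not at hS
    obtain ⟨x, hxI, hxS, hxu⟩ := hS
    obtain ⟨A, B, hA, hB, rfl, hAB⟩ := h.split hxI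
    have hlt : B.card < n := by
      rw [← hn]
      refine Finset.card_lt_card ⟨Finset.subset_union_right, fun hsub => ?_⟩
      have huA := hA.start_mem
      exact hxu (hAB u huA (hsub (Finset.mem_union_left _ huA))).symm
    obtain ⟨u', hu', v', hv', J, hJ, hr⟩ := ih _ hlt hB hxS hv rfl
    exact ⟨u', hu', v', hv', J, hJ.trans Finset.subset_union_right, hr⟩

/-- The segment of a path given by its sequence of vertices. -/
theorem pathOn_segment {p : ℕ → V} {i j : ℕ} (hij : i ≤ j)
    (hadj : ∀ l, i ≤ l → l < j → G.Adj (p l) (p (l + 1)))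
    (hinj : Set.InjOn p (Set.Icc i j)) : PathOn G (p i) (p j) ((Finset.Icc i j).image p) := by
  induction j, hij using Nat.le_induction with
  | base => simpa using PathOn.refl (p i)
  | succ j hij ih =>
    have h1 := ih (fun l h h' => hadj l h (by omega))
      (hinj.mono (Set.Icc_subset_Icc_right (by omega)))
    have h2 := h1.append (PathOn.of_adj (hadj j hij (by omega))) (by
      intro x hx hx'
      simp only [Finset.mem_image, Finset.mem_Icc] at hx
      simp only [Finset.mem_insert, Finset.mem_singleton] at hx'
      obtain ⟨l, hl, rfl⟩ := hx
      rcases hx' with hx' | hx'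
      · exact hx'
      · have := hinj ⟨hl.1, by omega⟩ ⟨by omega, le_rfl⟩ hx'
        omega)
    convert h2 using 1
    ext x
    simp only [Finset.mem_image, Finset.mem_Icc, Finset.mem_union, Finset.mem_insert,
      Finset.mem_singleton]
    constructor
    · rintro ⟨l, hl, rfl⟩
      rcases Nat.lt_or_ge j l with h | h
      · right; right; congr 1; omega
      · left; exact ⟨l, ⟨hl.1, h⟩, rfl⟩
    · rintro (⟨l, hl, rfl⟩ | rfl | rfl)
      · exact ⟨l, by omega, rfl⟩
      · exact ⟨j, by omega, rfl⟩
      · exact ⟨j + 1, by omega, rfl⟩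

end PathOn

section Kopylov

variable {V : Type*} [DecidableEq V] {G : SimpleGraph V}

/-- Two disjoint paths from `p s₁`, `p s₂` with `s₁, s₂ ≤ a`, one of which is `a`, to `p c`, `p d`
that meet `p 0, …, p a` and `p c, …, p m` only in their ends. -/
def Linked (G : SimpleGraph V) (p : ℕ → V) (m a c d : ℕ) : Prop :=
  ∃ s₁ s₂ A₁ A₂, s₁ ≤ a ∧ s₂ ≤ a ∧ s₁ ≠ s₂ ∧ (s₁ = a ∨ s₂ = a) ∧
    PathOn G (p s₁) (p c) A₁ ∧ PathOn G (p s₂) (p d) A₂ ∧ (∀ x ∈ A₁, x ∉ A₂) ∧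
    (∀ i ≤ a, p i ∈ A₁ → i = s₁) ∧ (∀ i ≤ a, p i ∈ A₂ → i = s₂) ∧
    (∀ i, c ≤ i → i ≤ m → p i ∈ A₁ → i = c) ∧ (∀ i, c ≤ i → i ≤ m → p i ∈ A₂ → i = d)

variable {p : ℕ → V} {m : ℕ}

theorem Linked.init (hinj : ∀ i j, i ≤ m → j ≤ m → p i = p j → i = j)
    (hconn : ∀ w x y, x ≠ w → y ≠ w → ∃ I, PathOn G x y I ∧ w ∉ I)
    {a : ℕ} (ha : 0 < a) (ham : a < m) : ∃ d, a < d ∧ d ≤ m ∧ Linked G p m a a d := by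
  obtain ⟨I, hI, haI⟩ := hconn (p a) (p 0) (p m)
    (fun h => by have := hinj _ _ (by omega) (by omega) h; omega)
    (fun h => by have := hinj _ _ (by omega) (by omega) h; omega)
  obtain ⟨u, hu, v, hv, J, hJI, hJ, hJS, hJT⟩ := hI.exists_bridge
    (S := (Finset.Ico 0 a).image p) (T := (Finset.Ioc a m).image p)
    (Finset.mem_image_of_mem _ (by simp; omega)) (Finset.mem_image_of_mem _ (by simp; omega))
  obtain ⟨s, hs, rfl⟩ := Finset.mem_image.mp hu
  obtain ⟨d, hd, rfl⟩ := Finset.mem_image.mp hv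
  simp only [Finset.mem_Ico, Finset.mem_Ioc] at hs hd
  refine ⟨d, hd.1, hd.2, a, s, {p a}, J, le_rfl, by omega, by omega, Or.inl rfl, PathOn.refl _, hJ,
    ?_, ?_, ?_, ?_, ?_⟩
  · rintro x hx hx'
    rw [Finset.mem_singleton] at hx
    subst hx
    exact haI (hJI hx')
  · intro i hi h
    exact hinj _ _ (by omega) (by omega) (Finset.mem_singleton.mp h)
  · intro i hi h
    have hia : i ≠ a := by rintro rfl; exact haI (hJI h)
    exact hinj _ _ (by omega) (by omega)
      (hJS _ h (Finset.mem_image_of_mem _ (by simp; omega)))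
  · intro i hi hi' h
    exact hinj _ _ (by omega) (by omega) (Finset.mem_singleton.mp h)
  · intro i hi hi' h
    have hia : i ≠ a := by rintro rfl; exact haI (hJI h)
    exact hinj _ _ (by omega) (by omega)
      (hJT _ h (Finset.mem_image_of_mem _ (by simp; omega)))

theorem Linked.step (hadj : ∀ i < m, G.Adj (p i) (p (i + 1)))
    (hinj : ∀ i j, i ≤ m → j ≤ m → p i = p j → i = j)
    (hconn : ∀ w x y, x ≠ w → y ≠ w → ∃ I, PathOn G x y I ∧ w ∉ I)
    {a c d : ℕ} (hac : a ≤ c) (hcd : c < d) (hdm : d < m) (h : Linked G p m a c d) :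
    ∃ f, d < f ∧ f ≤ m ∧ Linked G p m a d f := by
  obtain ⟨s₁, s₂, A₁, A₂, hs₁, hs₂, hs, hsa, hA₁, hA₂, hdis, hL₁, hL₂, hR₁, hR₂⟩ := h
  have hX : PathOn G (p s₁) (p d) (A₁ ∪ (Finset.Icc c d).image p) := by
    refine hA₁.append (pathOn_segment hcd.le (fun l _ h => hadj l (by omega)) ?_) ?_
    · intro i hi j hj h
      exact hinj _ _ (by have := hi.2; omega) (by have := hj.2; omega) h
    · intro x hx hx'
      obtain ⟨i, hi, rfl⟩ := Finset.mem_image.mp hx'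
      rw [Finset.mem_Icc] at hi
      rw [hR₁ i hi.1 (by omega) hx]
  obtain ⟨I, hI, haI⟩ := hconn (p d) (p c) (p m)
    (fun h => by have := hinj _ _ (by omega) (by omega) h; omega)
    (fun h => by have := hinj _ _ (by omega) (by omega) h; omega)
  obtain ⟨u, hu, v, hv, J, hJI, hJ, hJS, hJT⟩ := hI.exists_bridge
    (S := ((Finset.Icc 0 a).image p ∪ A₁ ∪ A₂ ∪ (Finset.Ico c d).image p).erase (p d))
    (T := (Finset.Ioc d m).image p)
    (by
      rw [Finset.mem_erase]
      refine ⟨fun h => by have := hinj _ _ (by omega) (by omega) h; omega, ?_⟩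
      exact Finset.mem_union_right _ (Finset.mem_image_of_mem _ (by simp; omega)))
    (Finset.mem_image_of_mem _ (by simp; omega))
  obtain ⟨f, hf, rfl⟩ := Finset.mem_image.mp hv
  rw [Finset.mem_Ioc] at hf
  have hdJ : p d ∉ J := fun h => haI (hJI h)
  have hJL : ∀ i ≤ a, p i ∈ J → p i = u := by
    intro i hi h
    refine hJS _ h (Finset.mem_erase.mpr ⟨fun h' => hdJ (h' ▸ h), ?_⟩)
    simp only [Finset.mem_union, Finset.mem_image]
    exact Or.inl (Or.inl (Or.inl ⟨i, by simp; omega, rfl⟩))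
  have hJ1 : ∀ x ∈ A₁, x ∈ J → x = u := by
    intro x hx h
    exact hJS _ h (Finset.mem_erase.mpr ⟨fun h' => hdJ (h' ▸ h), by simp [hx]⟩)
  have hJ2 : ∀ x ∈ A₂, x ∈ J → x = u := by
    intro x hx h
    exact hJS _ h (Finset.mem_erase.mpr ⟨fun h' => hdJ (h' ▸ h), by simp [hx]⟩)
  have hJ3 : ∀ i, c ≤ i → i ≤ d → p i ∈ J → p i = u := by
    intro i hi hi' h
    have hid : i ≠ d := by rintro rfl; exact hdJ h
    refine hJS _ h (Finset.mem_erase.mpr ⟨fun h' => hdJ (h' ▸ h), ?_⟩)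
    simp only [Finset.mem_union, Finset.mem_image]
    exact Or.inr ⟨i, by simp; omega, rfl⟩
  have hJR : ∀ i, d ≤ i → i ≤ m → p i ∈ J → i = f := by
    intro i hi hi' h
    have hid : i ≠ d := by rintro rfl; exact hdJ h
    exact hinj _ _ (by omega) (by omega)
      (hJT _ h (Finset.mem_image_of_mem _ (by simp; omega)))
  have hmseg : ∀ i ≤ m, p i ∈ (Finset.Icc c d).image p → c ≤ i ∧ i ≤ d := by
    intro i hi h
    obtain ⟨l, hl, hl'⟩ := Finset.mem_image.mp h
    rw [Finset.mem_Icc] at hl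
    have := hinj _ _ (by omega) (by omega) hl'
    omega
  have hcA₁ := hA₁.end_mem
  have hdA₂ := hA₂.end_mem
  have hsegA₂ : ∀ x ∈ (Finset.Icc c d).image p, x ∈ A₂ → x = p d := by
    intro x hx hx'
    obtain ⟨i, hi, rfl⟩ := Finset.mem_image.mp hx
    rw [Finset.mem_Icc] at hi
    rw [hR₂ i hi.1 (by omega) hx']
  have huJ := hJ.start_mem
  have huS' : (∃ l ≤ a, u = p l) ∨ u ∈ A₁ ∪ (Finset.Icc c d).image p ∨ u ∈ A₂ := by
    have := Finset.mem_of_mem_erase hu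
    simp only [Finset.mem_union, Finset.mem_image, Finset.mem_Icc, Finset.mem_Ico] at this ⊢
    rcases this with ((⟨l, hl, rfl⟩ | h) | h) | ⟨i, hi, rfl⟩
    · exact Or.inl ⟨l, hl.2, rfl⟩
    · exact Or.inr (Or.inl (Or.inl h))
    · exact Or.inr (Or.inr h)
    · exact Or.inr (Or.inl (Or.inr ⟨i, by omega, rfl⟩))
  have hud : u ≠ p d := fun h => hdJ (h ▸ huJ)
  have hXL : ∀ i ≤ a, p i ∈ A₁ ∪ (Finset.Icc c d).image p → i = s₁ := by
    intro i hi h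
    rcases Finset.mem_union.mp h with h | h
    · exact hL₁ i hi h
    · have := hmseg i (by omega) h
      have hic : i = c := by omega
      subst hic
      exact hL₁ i hi hcA₁
  have hXR : ∀ i, d ≤ i → i ≤ m → p i ∈ A₁ ∪ (Finset.Icc c d).image p → i = d := by
    intro i hi him h
    rcases Finset.mem_union.mp h with h | h
    · have := hR₁ i (by omega) him h
      omega
    · have := hmseg i him h
      omega
  have hJX : ∀ x ∈ A₁ ∪ (Finset.Icc c d).image p, x ∈ J → x = u := by
    intro x hx h
    rcases Finset.mem_union.mp hx with hx | hx
    · exact hJ1 x hx h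
    · obtain ⟨i, hi, rfl⟩ := Finset.mem_image.mp hx
      rw [Finset.mem_Icc] at hi
      exact hJ3 i hi.1 hi.2 h
  have hXA₂ : ∀ x ∈ A₁ ∪ (Finset.Icc c d).image p, x ∈ A₂ → x = p d := by
    intro x hx h
    rcases Finset.mem_union.mp hx with hx | hx
    · exact absurd h (hdis x hx)
    · exact hsegA₂ x hx h
  generalize A₁ ∪ (Finset.Icc c d).image p = X at hX hXL hJX hXA₂ hXR huS'
  have huL : ∀ l ≤ a, u = p l → ∀ i ≤ a, p i ∈ J → i = l := by
    intro l hl hul i hi h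
    exact hinj _ _ (by omega) (by omega) ((hJL i hi h).trans hul)
  by_cases hu2 : u ∈ A₂
  · obtain ⟨B, B', hB, hB', rfl, hBB'⟩ := hA₂.split hu2
    have hdB : p d ∉ B := fun h => hud (hBB' _ h hB'.end_mem).symm
    refine ⟨f, hf.1, hf.2, s₁, s₂, X, B ∪ J, hs₁, hs₂, hs, hsa, hX,
      hB.append hJ fun x hx hx' => hJ2 x (Finset.mem_union_left _ hx) hx', ?_, hXL, ?_, hXR, ?_⟩
    · intro x hx hx'
      rcases Finset.mem_union.mp hx' with h | h
      · exact hdB (hXA₂ x hx (Finset.mem_union_left _ h) ▸ h)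
      · have hxu := hJX x hx h
        subst hxu
        exact hud (hXA₂ x hx hu2)
    · intro i hi h
      rcases Finset.mem_union.mp h with h | h
      · exact hL₂ i hi (Finset.mem_union_left _ h)
      · exact hL₂ i hi (hJL i hi h ▸ hu2)
    · intro i hi him h
      rcases Finset.mem_union.mp h with h | h
      · have := hR₂ i (by omega) him (Finset.mem_union_left _ h)
        exact absurd (this ▸ h) hdB
      · exact hJR i hi him h
  by_cases hu1 : u ∈ X
  · obtain ⟨B, B', hB, hB', rfl, hBB'⟩ := hX.split hu1
    have hdB : p d ∉ B := fun h => hud (hBB' _ h hB'.end_mem).symm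
    refine ⟨f, hf.1, hf.2, s₂, s₁, A₂, B ∪ J, hs₂, hs₁, hs.symm, hsa.symm, hA₂,
      hB.append hJ fun x hx hx' => hJX x (Finset.mem_union_left _ hx) hx', ?_, hL₂, ?_,
      fun i hi => hR₂ i (by omega), ?_⟩
    · intro x hx hx'
      rcases Finset.mem_union.mp hx' with h | h
      · exact hdB (hXA₂ x (Finset.mem_union_left _ h) hx ▸ h)
      · exact hu2 (hJ2 x hx h ▸ hx)
    · intro i hi h
      rcases Finset.mem_union.mp h with h | h
      · exact hXL i hi (Finset.mem_union_left _ h)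
      · exact hXL i hi (hJL i hi h ▸ hu1)
    · intro i hi him h
      rcases Finset.mem_union.mp h with h | h
      · have := hXR i (by omega) him (Finset.mem_union_left _ h)
        exact absurd (this ▸ h) hdB
      · exact hJR i hi him h
  obtain ⟨l, hl, rfl⟩ : ∃ l ≤ a, u = p l := by
    rcases huS' with h | h | h
    · exact h
    · exact absurd h hu1
    · exact absurd h hu2
  rcases hsa with rfl | rfl
  · exact ⟨f, hf.1, hf.2, s₁, l, X, J, hs₁, hl, fun h => hu1 (h ▸ hX.start_mem), Or.inl rfl, hX, hJ,
      fun x hx h => hu1 (hJX x hx h ▸ hx), hXL, huL l hl rfl, hXR, hJR⟩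
  · exact ⟨f, hf.1, hf.2, s₂, l, A₂, J, hs₂, hl, fun h => hu2 (h ▸ hA₂.start_mem), Or.inl rfl, hA₂,
      hJ, fun x hx h => hu2 (hJ2 x hx h ▸ hx), hL₂, huL l hl rfl, fun i hi => hR₂ i (by omega), hJR⟩

theorem exists_linked (hadj : ∀ i < m, G.Adj (p i) (p (i + 1)))
    (hinj : ∀ i j, i ≤ m → j ≤ m → p i = p j → i = j)
    (hconn : ∀ w x y, x ≠ w → y ≠ w → ∃ I, PathOn G x y I ∧ w ∉ I)
    {a b : ℕ} (ha : 0 < a) (hab : a ≤ b) (hbm : b < m) :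
    ∃ c d, a ≤ c ∧ c ≤ b ∧ b < d ∧ d ≤ m ∧ Linked G p m a c d := by
  have key : ∀ N c d, m - d ≤ N → a ≤ c → c ≤ b → c < d → d ≤ m → Linked G p m a c d →
      ∃ c d, a ≤ c ∧ c ≤ b ∧ b < d ∧ d ≤ m ∧ Linked G p m a c d := by
    intro N
    induction N with
    | zero => exact fun c d hN hac hcb hcd hdm h => ⟨c, d, hac, hcb, by omega, hdm, h⟩
    | succ N ih =>
      intro c d hN hac hcb hcd hdm h
      by_cases hbd : b < d
      · exact ⟨c, d, hac, hcb, hbd, hdm, h⟩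
      · obtain ⟨f, hdf, hfm, hf⟩ := h.step hadj hinj hconn hac hcd (by omega)
        exact ih d f (by omega) (by omega) (by omega) hdf hfm hf
  obtain ⟨d, had, hdm, h⟩ := Linked.init hinj hconn ha (by omega)
  exact key _ a d le_rfl le_rfl hab had hdm h
theorem pathOn_image_segment (hadj : ∀ i < m, G.Adj (p i) (p (i + 1)))
    (hinj : ∀ i j, i ≤ m → j ≤ m → p i = p j → i = j) {i j : ℕ} (hij : i ≤ j) (hjm : j ≤ m) :
    PathOn G (p i) (p j) ((Finset.Icc i j).image p) :=
  pathOn_segment hij (fun l _ h => hadj l (by omega)) fun x hx y hy h =>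
    hinj _ _ (by have := hx.2; omega) (by have := hy.2; omega) h

/-- Two disjoint segments of a path joined by an edge. -/
theorem pathOn_two_segments (hadj : ∀ i < m, G.Adj (p i) (p (i + 1)))
    (hinj : ∀ i j, i ≤ m → j ≤ m → p i = p j → i = j) {i j k l : ℕ} (hij : i ≤ j) (hjk : j < k)
    (hkl : k ≤ l) (hlm : l ≤ m) {u v u' v' : V}
    (hu : u = p i ∧ u' = p j ∨ u = p j ∧ u' = p i) (hv : v = p k ∧ v' = p l ∨ v = p l ∧ v' = p k)
    (huv : G.Adj u' v) :
    PathOn G u v' ((Finset.Icc i j ∪ Finset.Icc k l).image p) := by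
  have h1 : PathOn G u u' ((Finset.Icc i j).image p) := by
    have := pathOn_image_segment hadj hinj hij (by omega)
    rcases hu with ⟨rfl, rfl⟩ | ⟨rfl, rfl⟩
    · exact this
    · exact this.symm
  have h2 : PathOn G v v' ((Finset.Icc k l).image p) := by
    have := pathOn_image_segment hadj hinj hkl hlm
    rcases hv with ⟨rfl, rfl⟩ | ⟨rfl, rfl⟩
    · exact this
    · exact this.symm
  have hdis : ∀ x ∈ (Finset.Icc i j).image p, x ∉ (Finset.Icc k l).image p := by
    intro x hx hx'
    obtain ⟨s, hs, rfl⟩ := Finset.mem_image.mp hx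
    obtain ⟨t, ht, hst⟩ := Finset.mem_image.mp hx'
    rw [Finset.mem_Icc] at hs ht
    have := hinj _ _ (by omega) (by omega) hst
    omega
  have hu' := h1.end_mem
  have hv' := h2.start_mem
  have h3 := (h1.append (PathOn.of_adj huv) (by grind)).append h2 (by grind)
  convert h3 using 1
  rw [Finset.image_union]
  grind

theorem exists_pathOn_initial (hadj : ∀ i < m, G.Adj (p i) (p (i + 1)))
    (hinj : ∀ i j, i ≤ m → j ≤ m → p i = p j → i = j) {a s : ℕ} (ham : a ≤ m) (hsa : s < a)
    (ha : G.Adj (p 0) (p a)) :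
    ∃ K ⊆ Finset.Icc 0 a, PathOn G (p s) (p a) (K.image p) ∧ 0 ∈ K ∧
      ∀ j ≤ a, G.Adj (p 0) (p j) → j ∈ K := by
  classical
  have hex : ∃ j, s < j ∧ G.Adj (p 0) (p j) := ⟨a, hsa, ha⟩
  obtain ⟨h1, h2⟩ := Nat.find_spec hex
  have h3 : Nat.find hex ≤ a := Nat.find_le ⟨hsa, ha⟩
  have h4 : ∀ j, s < j → G.Adj (p 0) (p j) → Nat.find hex ≤ j := fun j hj hj' =>
    Nat.find_le ⟨hj, hj'⟩
  generalize Nat.find hex = e at h1 h2 h3 h4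
  refine ⟨Finset.Icc 0 s ∪ Finset.Icc e a, ?_, pathOn_two_segments hadj hinj (by omega) h1 h3 ham
    (Or.inr ⟨rfl, rfl⟩) (Or.inl ⟨rfl, rfl⟩) h2, by simp, ?_⟩
  · intro x hx
    simp only [Finset.mem_union, Finset.mem_Icc] at hx ⊢
    omega
  · intro j hj hadj
    simp only [Finset.mem_union, Finset.mem_Icc]
    by_cases hjs : j ≤ s
    · omega
    · have := h4 j (by omega) hadj
      omega

theorem exists_pathOn_final (hadj : ∀ i < m, G.Adj (p i) (p (i + 1)))
    (hinj : ∀ i j, i ≤ m → j ≤ m → p i = p j → i = j) {b c d : ℕ} (hcb : c ≤ b) (hbd : b < d)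
    (hdm : d ≤ m) (hb : G.Adj (p m) (p b)) :
    ∃ K ⊆ Finset.Icc c m, PathOn G (p c) (p d) (K.image p) ∧ m ∈ K ∧
      ∀ j, b ≤ j → j ≤ m → G.Adj (p m) (p j) → j ∈ K := by
  classical
  set e := Nat.findGreatest (fun j => G.Adj (p m) (p j)) (d - 1) with he
  have h1 : e ≤ d - 1 := Nat.findGreatest_le _
  have h2 : b ≤ e := Nat.le_findGreatest (by omega) hb
  have h3 : G.Adj (p m) (p e) :=
    Nat.findGreatest_spec (P := fun j => G.Adj (p m) (p j)) (m := b) (by omega) hb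
  have h4 : ∀ j ≤ d - 1, G.Adj (p m) (p j) → j ≤ e := fun j hj hj' =>
    Nat.le_findGreatest hj hj'
  refine ⟨Finset.Icc c e ∪ Finset.Icc d m, ?_, pathOn_two_segments hadj hinj (by omega) (by omega)
    hdm le_rfl (Or.inl ⟨rfl, rfl⟩) (Or.inr ⟨rfl, rfl⟩) h3.symm, by simp; omega, ?_⟩
  · intro x hx
    simp only [Finset.mem_union, Finset.mem_Icc] at hx ⊢
    omega
  · intro j hj hjm hadj
    simp only [Finset.mem_union, Finset.mem_Icc]
    by_cases hjs : j ≤ d - 1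
    · have := h4 j hjs hadj
      omega
    · omega

theorem exists_isCycle_of_crossing (hadj : ∀ i < m, G.Adj (p i) (p (i + 1)))
    (hinj : ∀ i j, i ≤ m → j ≤ m → p i = p j → i = j) (hna : ¬ G.Adj (p 0) (p m))
    {D₀ Dm : Finset ℕ} (hD₀ : ∀ i ∈ D₀, i ≤ m ∧ G.Adj (p 0) (p i))
    (hDm : ∀ i ∈ Dm, i ≤ m ∧ G.Adj (p m) (p i)) (hcr : ∃ i ∈ Dm, ∃ j ∈ D₀, i < j) :
    ∃ (x : V) (C : G.Walk x x), C.IsCycle ∧ min (m + 1) (D₀.card + Dm.card) ≤ C.length := by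
  classical
  have hex : ∃ l, ∃ i ∈ Dm, ∃ j ∈ D₀, i < j ∧ j - i = l := by
    obtain ⟨i, hi, j, hj, hij⟩ := hcr
    exact ⟨_, i, hi, j, hj, hij, rfl⟩
  obtain ⟨i, hi, j, hj, hij, hl⟩ := Nat.find_spec hex
  have hmin : ∀ i' ∈ Dm, ∀ j' ∈ D₀, i' < j' → j - i ≤ j' - i' := fun i' hi' j' hj' hij' =>
    hl ▸ Nat.find_le ⟨i', hi', j', hj', hij', rfl⟩
  have hpos : ∀ i ∈ Dm, 0 < i := fun i hi => Nat.pos_of_ne_zero fun h =>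
    hna (h ▸ (hDm i hi).2).symm
  have hltm : ∀ i ∈ Dm, i < m := fun i hi =>
    lt_of_le_of_ne (hDm i hi).1 fun h => (hDm i hi).2.ne (by rw [h])
  have hjm : j < m := lt_of_le_of_ne (hD₀ j hj).1 fun h => hna (h ▸ (hD₀ j hj).2)
  have hi0 := hpos i hi
  have hpath := pathOn_two_segments hadj hinj (Nat.zero_le i) hij hjm.le le_rfl
    (Or.inr ⟨rfl, rfl⟩) (Or.inl ⟨rfl, rfl⟩) (hD₀ j hj).2
  have hcard : ((Finset.Icc 0 i ∪ Finset.Icc j m).image p).card = (i + 1) + (m + 1 - j) := by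
    rw [Finset.card_image_of_injOn, Finset.card_union_of_disjoint]
    · simp
    · rw [Finset.disjoint_left]
      intro x hx hx'
      rw [Finset.mem_Icc] at hx hx'
      omega
    · intro x hx y hy h
      simp only [Finset.coe_union, Finset.coe_Icc, Set.mem_union, Set.mem_Icc] at hx hy
      exact hinj _ _ (by omega) (by omega) h
  obtain ⟨x, C, hC, hCl⟩ := exists_isCycle_of_pathOn_adj hpath (hDm i hi).2.symm (by omega)
  refine ⟨x, C, hC, ?_⟩
  rw [hCl, hcard]
  by_cases hji : j = i + 1
  · exact (min_le_left _ _).trans (by omega)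
  refine (min_le_right _ _).trans ?_
  have h0 : ∀ e ∈ D₀, 0 < e := fun e he => Nat.pos_of_ne_zero fun h =>
    (hD₀ e he).2.ne (by rw [h])
  rw [← Finset.card_image_of_injOn (s := D₀) (f := Nat.pred) (by
    intro x hx y hy h
    have := h0 x hx
    have := h0 y hy
    simp only [Nat.pred_eq_sub_one] at h
    omega), ← Finset.card_union_of_disjoint]
  · have hsub : D₀.image Nat.pred ∪ Dm ⊆ Finset.Icc 0 i ∪ Finset.Icc (j - 1) (m - 1) := by
      intro e he
      simp only [Finset.mem_union, Finset.mem_Icc]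
      rcases Finset.mem_union.mp he with he | he
      · obtain ⟨f, hf, rfl⟩ := Finset.mem_image.mp he
        have := h0 f hf
        have := (hD₀ f hf).1
        simp only [Nat.pred_eq_sub_one]
        by_cases hfi : i < f
        · have := hmin i hi f hf hfi
          omega
        · omega
      · have := hltm e he
        by_cases hej : e < j
        · have := hmin e he j hj hej
          omega
        · omega
    refine (Finset.card_le_card hsub).trans ((Finset.card_union_le _ _).trans ?_)
    simp only [Nat.card_Icc]
    omega
  · rw [Finset.disjoint_left]
    intro e he he'
    obtain ⟨f, hf, rfl⟩ := Finset.mem_image.mp he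
    have := h0 f hf
    have := hmin _ he' f hf (by simp only [Nat.pred_eq_sub_one]; omega)
    simp only [Nat.pred_eq_sub_one] at this
    omega

theorem exists_isCycle_of_not_crossing (hadj : ∀ i < m, G.Adj (p i) (p (i + 1)))
    (hinj : ∀ i j, i ≤ m → j ≤ m → p i = p j → i = j) (hm : 0 < m) (hna : ¬ G.Adj (p 0) (p m))
    (hconn : ∀ w x y, x ≠ w → y ≠ w → ∃ I, PathOn G x y I ∧ w ∉ I)
    {D₀ Dm : Finset ℕ} (hD₀ : ∀ i, i ∈ D₀ ↔ i ≤ m ∧ G.Adj (p 0) (p i))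
    (hDm : ∀ i, i ∈ Dm ↔ i ≤ m ∧ G.Adj (p m) (p i)) (hcr : ∀ i ∈ Dm, ∀ j ∈ D₀, j ≤ i) :
    ∃ (x : V) (C : G.Walk x x), C.IsCycle ∧ D₀.card + Dm.card ≤ C.length := by
  have hne₀ : D₀.Nonempty := ⟨1, (hD₀ 1).2 ⟨hm, hadj 0 hm⟩⟩
  have hnem : Dm.Nonempty := ⟨m - 1, (hDm _).2 ⟨by omega, by
    have := hadj (m - 1) (by omega)
    rw [Nat.sub_add_cancel hm] at this
    exact this.symm⟩⟩
  obtain ⟨a, haD, ha⟩ : ∃ a ∈ D₀, ∀ j ∈ D₀, j ≤ a := ⟨_, D₀.max'_mem hne₀, fun j => D₀.le_max' j⟩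
  obtain ⟨b, hbD, hb⟩ : ∃ b ∈ Dm, ∀ j ∈ Dm, b ≤ j := ⟨_, Dm.min'_mem hnem, fun j => Dm.min'_le j⟩
  obtain ⟨ham, haA⟩ := (hD₀ a).1 haD
  obtain ⟨hbm, hbA⟩ := (hDm b).1 hbD
  have ha0 : 0 < a := Nat.pos_of_ne_zero fun h => haA.ne (by rw [h])
  have hbm : b < m := lt_of_le_of_ne hbm fun h => hbA.ne (by rw [h])
  have hab := hcr b hbD a haD
  obtain ⟨c, d, hac, hcb, hbd, hdm, s₁, s₂, A₁, A₂, hs₁, hs₂, hs, hsa, hA₁, hA₂, hdis, hL₁, hL₂,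
    hR₁, hR₂⟩ := exists_linked hadj hinj hconn ha0 hab hbm
  obtain ⟨K, hKa, hK, h0K, hDK⟩ : ∃ K ⊆ Finset.Icc 0 a, PathOn G (p s₁) (p s₂) (K.image p) ∧ 0 ∈ K ∧
      ∀ j ≤ a, G.Adj (p 0) (p j) → j ∈ K := by
    rcases hsa with rfl | rfl
    · obtain ⟨K, h1, h2, h3⟩ := exists_pathOn_initial hadj hinj ham (s := s₂) (by omega) haA
      exact ⟨K, h1, h2.symm, h3⟩
    · exact exists_pathOn_initial hadj hinj ham (by omega) haA
  obtain ⟨K', hKc, hK', hmK, hDK'⟩ := exists_pathOn_final hadj hinj hcb hbd hdm hbA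
  have hK'm : ∀ x ∈ K'.image p, ∃ i, c ≤ i ∧ i ≤ m ∧ x = p i := by
    intro x hx
    obtain ⟨i, hi, rfl⟩ := Finset.mem_image.mp hx
    have := Finset.mem_Icc.mp (hKc hi)
    exact ⟨i, this.1, this.2, rfl⟩
  have h1 := hA₁.append hK' fun x hx hx' => by
    obtain ⟨i, hi, him, rfl⟩ := hK'm x hx'
    rw [hR₁ i hi him hx]
  have h2 := h1.append hA₂.symm fun x hx hx' => by
    rcases Finset.mem_union.mp hx with hx | hx
    · exact absurd hx' (hdis x hx)
    · obtain ⟨i, hi, him, rfl⟩ := hK'm x hx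
      rw [hR₂ i hi him hx']
  have hcA := hA₁.end_mem
  have hmeet : ∀ x ∈ A₁ ∪ K'.image p ∪ A₂, x ∈ K.image p → x = p s₁ ∨ x = p s₂ := by
    intro x hx hx'
    obtain ⟨i, hi, rfl⟩ := Finset.mem_image.mp hx'
    have hia := (Finset.mem_Icc.mp (hKa hi)).2
    rcases Finset.mem_union.mp hx with hx | hx
    · rcases Finset.mem_union.mp hx with hx | hx
      · rw [hL₁ i hia hx]; exact Or.inl rfl
      · obtain ⟨j, hj, hjm, hij⟩ := hK'm _ hx
        have := hinj _ _ (by omega) hjm hij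
        have hic : i = c := by omega
        subst hic
        rw [hL₁ i hia hcA]; exact Or.inl rfl
    · rw [hL₂ i hia hx]; exact Or.inr rfl
  have hcard : D₀.card + Dm.card + 1 ≤ ((A₁ ∪ K'.image p ∪ A₂) ∪ K.image p).card := by
    have hsub : (insert 0 D₀ ∪ insert m Dm).image p ⊆ (A₁ ∪ K'.image p ∪ A₂) ∪ K.image p := by
      intro x hx
      obtain ⟨i, hi, rfl⟩ := Finset.mem_image.mp hx
      have : i ∈ K ∨ i ∈ K' := by
        simp only [Finset.mem_union, Finset.mem_insert] at hi
        rcases hi with (rfl | hi) | (rfl | hi)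
        · exact Or.inl h0K
        · exact Or.inl (hDK i (ha i hi) ((hD₀ i).1 hi).2)
        · exact Or.inr hmK
        · exact Or.inr (hDK' i (hb i hi) ((hDm i).1 hi).1 ((hDm i).1 hi).2)
      simp only [Finset.mem_union]
      rcases this with h | h
      · exact Or.inr (Finset.mem_image_of_mem _ h)
      · exact Or.inl (Or.inl (Or.inr (Finset.mem_image_of_mem _ h)))
    have hle := Finset.card_le_card hsub
    rw [Finset.card_image_of_injOn (by
      intro x hx y hy h
      have aux : ∀ z, z ∈ (↑(insert 0 D₀ ∪ insert m Dm) : Set ℕ) → z ≤ m := by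
        intro z hz
        simp only [Finset.coe_union, Finset.coe_insert, Set.mem_union, Set.mem_insert_iff,
          Finset.mem_coe] at hz
        rcases hz with (rfl | hz) | (rfl | hz)
        · omega
        · exact ((hD₀ z).1 hz).1
        · exact le_rfl
        · exact ((hDm z).1 hz).1
      exact hinj _ _ (aux x hx) (aux y hy) h)] at hle
    have hui := Finset.card_union_add_card_inter (insert 0 D₀) (insert m Dm)
    have h0 : 0 ∉ D₀ := fun h => ((hD₀ 0).1 h).2.ne rfl
    have hmD : m ∉ Dm := fun h => ((hDm m).1 h).2.ne rfl
    rw [Finset.card_insert_of_notMem h0, Finset.card_insert_of_notMem hmD] at hui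
    have hint : (insert 0 D₀ ∩ insert m Dm).card ≤ 1 := by
      rw [← Finset.card_singleton a]
      refine Finset.card_le_card fun z hz => ?_
      simp only [Finset.mem_inter, Finset.mem_insert] at hz
      rw [Finset.mem_singleton]
      have hz1 : z ≤ a := by
        rcases hz.1 with rfl | h
        · omega
        · exact ha z h
      have hz2 : b ≤ z := by
        rcases hz.2 with rfl | h
        · omega
        · exact hb z h
      omega
    omega
  have hpos₀ := hne₀.card_pos
  have hposm := hnem.card_pos
  obtain ⟨x, C, hC, hCl⟩ := exists_isCycle_of_pathOn h2 hK hmeet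
    (fun h => hs (hinj _ _ (by omega) (by omega) h)) (by omega)
  exact ⟨x, C, hC, by omega⟩

/-- **Kopylov's lemma**: in a `2`-connected graph, a path with `m` edges and nonadjacent ends gives
a cycle of length at least `m + 1` or the sum of the degrees of its ends into the path. -/
theorem exists_isCycle_min_le_length (hadj : ∀ i < m, G.Adj (p i) (p (i + 1)))
    (hinj : ∀ i j, i ≤ m → j ≤ m → p i = p j → i = j) (hm : 0 < m) (hna : ¬ G.Adj (p 0) (p m))
    (hconn : ∀ w x y, x ≠ w → y ≠ w → ∃ I, PathOn G x y I ∧ w ∉ I)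
    {D₀ Dm : Finset ℕ} (hD₀ : ∀ i, i ∈ D₀ ↔ i ≤ m ∧ G.Adj (p 0) (p i))
    (hDm : ∀ i, i ∈ Dm ↔ i ≤ m ∧ G.Adj (p m) (p i)) :
    ∃ (x : V) (C : G.Walk x x), C.IsCycle ∧ min (m + 1) (D₀.card + Dm.card) ≤ C.length := by
  by_cases hcr : ∃ i ∈ Dm, ∃ j ∈ D₀, i < j
  · exact exists_isCycle_of_crossing hadj hinj hna (fun i => (hD₀ i).1) (fun i => (hDm i).1) hcr
  · push Not at hcr
    obtain ⟨x, C, hC, h⟩ := exists_isCycle_of_not_crossing hadj hinj hm hna hconn hD₀ hDm hcr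
    exact ⟨x, C, hC, (min_le_right _ _).trans h⟩

end Kopylov

section Saturation

theorem SimpleGraph.Walk.IsCycle.exists_periodic {V : Type*} {G : SimpleGraph V}
    {v : V} {C : G.Walk v v} (hC : C.IsCycle) :
    ∃ f : ℕ → V, (∀ i, G.Adj (f i) (f (i + 1))) ∧
      ∀ i j, f i = f j ↔ i % C.length = j % C.length := by
  have hL := hC.three_le_length
  refine ⟨fun i => C.getVert (i % C.length), fun i => ?_, fun i j => ⟨fun h => ?_, fun h => ?_⟩⟩
  · change G.Adj (C.getVert (i % C.length)) (C.getVert ((i + 1) % C.length))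
    have hi := Nat.mod_lt i (show 0 < C.length by omega)
    have hadj := C.adj_getVert_succ hi
    by_cases hlt : i % C.length + 1 < C.length
    · rwa [show (i + 1) % C.length = i % C.length + 1 by
        rw [Nat.add_mod, Nat.mod_eq_of_lt (show 1 < C.length by omega), Nat.mod_eq_of_lt hlt]]
    · have heq : i % C.length + 1 = C.length := by omega
      rw [heq, C.getVert_length] at hadj
      rw [show (i + 1) % C.length = 0 by
        rw [Nat.add_mod, Nat.mod_eq_of_lt (show 1 < C.length by omega), heq, Nat.mod_self],
        C.getVert_zero]
      exact hadj
  · have hi := Nat.mod_lt i (show 0 < C.length by omega)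
    have hj := Nat.mod_lt j (show 0 < C.length by omega)
    exact hC.getVert_injOn' (by simp only [Set.mem_ofPred_eq]; omega)
      (by simp only [Set.mem_ofPred_eq]; omega) h
  · simp only [h]

variable {V : Type*} [DecidableEq V] {G : SimpleGraph V}

theorem exists_pathOn_of_periodic {f : ℕ → V} {L : ℕ} (hL : 3 ≤ L) {i : ℕ}
    (hf : ∀ i j, f i = f j ↔ i % L = j % L)
    (hadj : ∀ l, l < L - 1 → G.Adj (f (i + 1 + l)) (f (i + 1 + l + 1))) :
    ∃ S, PathOn G (f (i + 1)) (f i) S ∧ S.card = L := by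
  have hinj : Set.InjOn (fun l => f (i + 1 + l)) (Set.Icc 0 (L - 1)) := by
    intro x hx y hy h
    rw [Set.mem_Icc] at hx hy
    have := (hf _ _).1 h
    have h2 : x ≡ y [MOD L] := Nat.ModEq.add_left_cancel' (i + 1) this
    exact Nat.ModEq.eq_of_lt_of_lt h2 (by omega) (by omega)
  have := pathOn_segment (G := G) (p := fun l => f (i + 1 + l)) (Nat.zero_le (L - 1))
    (fun l _ hl => hadj l hl) hinj
  refine ⟨(Finset.Icc 0 (L - 1)).image fun l => f (i + 1 + l), ?_, ?_⟩
  · have hend : f (i + 1 + (L - 1)) = f i := by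
      rw [hf, show i + 1 + (L - 1) = i + L by omega, Nat.add_mod_right]
    simp only [hend] at this
    exact this
  · rw [Finset.card_image_of_injOn (by simpa using hinj), Nat.card_Icc]
    omega

theorem exists_path_of_cycle_sup_edge {k : ℕ} {u v x : V} (huv : u ≠ v)
    (hG : ∀ (v : V) (C : G.Walk v v), C.IsCycle → C.length < k)
    {C : (G ⊔ edge u v).Walk x x} (hC : C.IsCycle) (hk : k ≤ C.length) :
    ∃ p : G.Walk u v, p.IsPath ∧ k ≤ p.length + 1 := by
  obtain ⟨f, hadj, hf⟩ := hC.exists_periodic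
  have hL := hC.three_le_length
  generalize C.length = L at *
  have hadj' : ∀ i, G.Adj (f i) (f (i + 1)) ∨
      f i = u ∧ f (i + 1) = v ∨ f i = v ∧ f (i + 1) = u := by
    intro i
    have := hadj i
    rw [sup_adj, edge_adj] at this
    tauto
  by_cases he : ∃ i, f i = u ∧ f (i + 1) = v ∨ f i = v ∧ f (i + 1) = u
  · obtain ⟨i, hi⟩ := he
    obtain ⟨S, hS, hcard⟩ := exists_pathOn_of_periodic (G := G) hL (i := i) hf (by
      intro l hl
      refine (hadj' (i + 1 + l)).resolve_right fun h => ?_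
      have hne : f (i + 1 + l) ≠ f i := by
        intro h'
        have h2 : i + (1 + l) ≡ i + 0 [MOD L] := by
          have := (hf _ _).1 h'
          rwa [add_assoc] at this
        have := Nat.ModEq.eq_of_lt_of_lt (Nat.ModEq.add_left_cancel' i h2) (by omega) (by omega)
        omega
      have hne' : f (i + 1 + l) = f (i + 1) → f (i + 1 + l + 1) ≠ f i := by
        intro h'' h'
        have h0 : i + 1 + l ≡ i + 1 + 0 [MOD L] := (hf _ _).1 h''
        have := Nat.ModEq.eq_of_lt_of_lt (Nat.ModEq.add_left_cancel' (i + 1) h0) (by omega)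
          (by omega)
        have h2 : i + (1 + l + 1) ≡ i + 0 [MOD L] := by
          have := (hf _ _).1 h'
          rwa [show i + 1 + l + 1 = i + (1 + l + 1) by omega] at this
        have := Nat.ModEq.eq_of_lt_of_lt (Nat.ModEq.add_left_cancel' i h2) (by omega) (by omega)
        omega
      grind)
    have hS' : PathOn G u v S := by
      rcases hi with ⟨rfl, rfl⟩ | ⟨rfl, rfl⟩
      · exact hS.symm
      · exact hS
    obtain ⟨p, hp, rfl⟩ := hS'
    refine ⟨p, hp, ?_⟩
    rw [List.toFinset_card_of_nodup hp.support_nodup, Walk.length_support] at hcard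
    omega
  · push Not at he
    have hadj2 : ∀ i, G.Adj (f i) (f (i + 1)) := by
      intro i
      have := he i
      have := hadj' i
      tauto
    obtain ⟨S, hS, hcard⟩ := exists_pathOn_of_periodic (G := G) hL (i := 0) hf
      (fun l _ => hadj2 _)
    obtain ⟨y, C, hC, hCl⟩ := exists_isCycle_of_pathOn_adj hS (hadj2 0).symm (by omega)
    have := hG y C hC
    omega

/-- Adding edges to a graph with no cycle of length at least `k`, one can reach such a graph in
which any two nonadjacent vertices are joined by a path on at least `k` vertices. -/
theorem exists_saturated [Finite V] {k : ℕ}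
    (hG : ∀ (v : V) (C : G.Walk v v), C.IsCycle → C.length < k) :
    ∃ G', G ≤ G' ∧ (∀ (v : V) (C : G'.Walk v v), C.IsCycle → C.length < k) ∧
      ∀ u v, u ≠ v → ¬ G'.Adj u v → ∃ p : G'.Walk u v, p.IsPath ∧ k ≤ p.length + 1 := by
  obtain ⟨G', hle, hG'⟩ := (Set.toFinite {H : SimpleGraph V | ∀ (v : V) (C : H.Walk v v),
    C.IsCycle → C.length < k}).exists_le_maximal hG
  refine ⟨G', hle, hG'.prop, fun u v huv hna => ?_⟩
  have hnot : G' ⊔ edge u v ∉ {H : SimpleGraph V | ∀ (v : V) (C : H.Walk v v),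
      C.IsCycle → C.length < k} := by
    intro hmem
    have := hG'.le_of_ge hmem le_sup_left
    exact hna (this (by rw [sup_adj, edge_adj]; tauto))
  simp only [Set.mem_ofPred_eq, not_forall, not_lt] at hnot
  obtain ⟨x, C, hC, hk⟩ := hnot
  exact exists_path_of_cycle_sup_edge huv hG'.prop hC hk

/-- Vertices reached from the ends of a longest path between nonadjacent vertices of `X` and `Y` lie
on that path, so Kopylov's lemma bounds the degrees. -/
theorem adj_of_degree_sum [Fintype V] [DecidableRel G.Adj] {k : ℕ} (hk : 3 ≤ k)
    (hG : ∀ (v : V) (C : G.Walk v v), C.IsCycle → C.length < k)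
    (hsat : ∀ u v, u ≠ v → ¬ G.Adj u v → ∃ p : G.Walk u v, p.IsPath ∧ k ≤ p.length + 1)
    (hconn : ∀ w x y, x ≠ w → y ≠ w → ∃ I, PathOn G x y I ∧ w ∉ I)
    {X Y X' Y' : Finset V} {d₁ d₂ : ℕ} (hd : k ≤ d₁ + d₂)
    (hX : ∀ x ∈ X, d₁ ≤ (X'.filter (G.Adj x)).card) (hY : ∀ y ∈ Y, d₂ ≤ (Y'.filter (G.Adj y)).card)
    (hXX' : ∀ x ∈ X', ∀ y ∈ Y, x ≠ y → ¬ G.Adj x y → x ∈ X)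
    (hYY' : ∀ y ∈ Y', ∀ x ∈ X, x ≠ y → ¬ G.Adj x y → y ∈ Y) :
    ∀ x ∈ X, ∀ y ∈ Y, x ≠ y → G.Adj x y := by
  intro x₀ hx₀ y₀ hy₀ hxy₀
  by_contra hna₀
  let P : ℕ → Prop := fun l => ∃ x ∈ X, ∃ y ∈ Y, x ≠ y ∧ ¬ G.Adj x y ∧
    ∃ p : G.Walk x y, p.IsPath ∧ p.length = l
  have hbound : ∀ l, P l → l ≤ Fintype.card V := by
    rintro l ⟨x, _, y, _, _, _, p, hp, rfl⟩
    exact hp.length_lt.le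
  obtain ⟨l, ⟨x, hx, y, hy, hxy, hna, p, hp, rfl⟩, hmax⟩ : ∃ l, P l ∧ ∀ l', P l' → l' ≤ l := by
    classical
    obtain ⟨q, hq, -⟩ := hsat x₀ y₀ hxy₀ hna₀
    have hPq : P q.length := ⟨x₀, hx₀, y₀, hy₀, hxy₀, hna₀, q, hq, rfl⟩
    exact ⟨Nat.findGreatest P (Fintype.card V), Nat.findGreatest_spec (hbound _ hPq) hPq,
      fun l' hl' => Nat.le_findGreatest (hbound _ hl') hl'⟩
  have hlen : k ≤ p.length + 1 := by
    obtain ⟨q, hq, hqk⟩ := hsat x y hxy hna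
    have := hmax _ ⟨x, hx, y, hy, hxy, hna, q, hq, rfl⟩
    omega
  have hnocyc : ∀ (u v : V) (q : G.Walk u v), q.IsPath → k ≤ q.length + 1 → ¬ G.Adj u v := by
    intro u v q hq hqk hadj
    have hcard : q.support.toFinset.card = q.length + 1 := by
      rw [List.toFinset_card_of_nodup hq.support_nodup, Walk.length_support]
    obtain ⟨z, C, hC, hCl⟩ := exists_isCycle_of_pathOn_adj ⟨q, hq, rfl⟩ hadj (by omega)
    have := hG z C hC
    omega
  have hx' : ∀ x' ∈ X', G.Adj x x' → x' ∈ p.support := by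
    intro x' hx' hadj
    by_contra hmem
    have hpath : (Walk.cons hadj.symm p).IsPath := hp.cons hmem
    have hne : x' ≠ y := fun h => hmem (h ▸ p.end_mem_support)
    have hna' := hnocyc _ _ _ hpath (by rw [Walk.length_cons]; omega)
    have := hmax _ ⟨x', hXX' x' hx' y hy hne hna', y, hy, hne, hna', _, hpath, rfl⟩
    rw [Walk.length_cons] at this
    omega
  have hy' : ∀ y' ∈ Y', G.Adj y y' → y' ∈ p.support := by
    intro y' hy' hadj
    by_contra hmem
    have hpath : (p.concat hadj).IsPath := hp.concat hmem hadj
    have hne : x ≠ y' := fun h => hmem (h ▸ p.start_mem_support)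
    have hna' := hnocyc _ _ _ hpath (by rw [Walk.length_concat]; omega)
    have := hmax _ ⟨x, hx, y', hYY' y' hy' x hx hne hna', hne, hna', _, hpath, rfl⟩
    rw [Walk.length_concat] at this
    omega
  obtain ⟨z, C, hC, hCl⟩ := exists_isCycle_min_le_length (G := G) (p := p.getVert) (m := p.length)
    (D₀ := (Finset.range (p.length + 1)).filter fun i => G.Adj (p.getVert 0) (p.getVert i))
    (Dm := (Finset.range (p.length + 1)).filter
      fun i => G.Adj (p.getVert p.length) (p.getVert i))
    (fun i hi => p.adj_getVert_succ hi) (fun i j hi hj h => hp.getVert_injOn hi hj h) (by omega)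
    (by simpa using hna) hconn (by intro i; simp) (by intro i; simp)
  have hcount : ∀ (w : V) (W : Finset V), (∀ w' ∈ W, G.Adj w w' → w' ∈ p.support) →
      (W.filter (G.Adj w)).card ≤
        ((Finset.range (p.length + 1)).filter fun i => G.Adj w (p.getVert i)).card := by
    intro w W hW
    refine (Finset.card_le_card fun w' hw' => ?_).trans (Finset.card_image_le (f := p.getVert))
    rw [Finset.mem_filter] at hw'
    obtain ⟨i, hi, hil⟩ := Walk.mem_support_iff_exists_getVert.mp (hW w' hw'.1 hw'.2)
    rw [Finset.mem_image]
    refine ⟨i, ?_, hi⟩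
    rw [Finset.mem_filter, Finset.mem_range]
    exact ⟨by omega, hi ▸ hw'.2⟩
  rw [p.getVert_zero, p.getVert_length] at hCl
  have h1 := (hX x hx).trans (hcount x X' hx')
  have h2 := (hY y hy).trans (hcount y Y' hy')
  have := hG z C hC
  omega

end Saturation

section Cores

theorem le_exK {n r : ℕ} {G : SimpleGraph (Fin n)} (hG : G.CliqueFree r) :
    G.edgeSet.ncard ≤ exK n r := by
  refine le_csSup ⟨Nat.card (Sym2 (Fin n)), ?_⟩ ⟨G, hG, rfl⟩
  rintro m ⟨H, -, rfl⟩
  exact (Set.ncard_le_ncard (Set.subset_univ _)).trans_eq (Set.ncard_univ _)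

variable {V : Type*} {G : SimpleGraph V}

/-- The number of edges of `G` with both ends in `S`. -/
noncomputable def edgesIn (G : SimpleGraph V) (S : Finset V) : ℕ :=
  {e | e ∈ G.edgeSet ∧ ∀ x ∈ e, x ∈ S}.ncard

theorem edgesIn_univ [Fintype V] : edgesIn G Finset.univ = G.edgeSet.ncard := by
  simp [edgesIn]

theorem edgesIn_le_exK {r : ℕ} (hG : G.CliqueFree r) (S : Finset V) :
    edgesIn G S ≤ exK S.card r := by
  let f : Fin S.card ↪ V := S.equivFin.symm.toEmbedding.trans (Function.Embedding.subtype _)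
  have hf : ∀ x ∈ S, ∃ i, f i = x := fun x hx => ⟨S.equivFin ⟨x, hx⟩, by simp [f]⟩
  refine le_trans ?_ (le_exK (hG.comap ⟨(Embedding.comap f G).toCopy⟩))
  refine le_trans (Set.ncard_le_ncard ?_)
    (Set.ncard_image_le (s := (G.comap f).edgeSet) (f := Sym2.map f))
  rintro e ⟨he, heS⟩
  induction e with
  | _ x y =>
    obtain ⟨i, rfl⟩ := hf x (heS x (by simp))
    obtain ⟨j, rfl⟩ := hf y (heS y (by simp))
    exact ⟨s(i, j), he, by simp⟩

theorem edgesIn_le_erase [Fintype V] [DecidableEq V] [DecidableRel G.Adj] (S : Finset V) (v : V) :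
    edgesIn G S ≤ edgesIn G (S.erase v) + (S.filter (G.Adj v)).card := by
  have hsub : {e | e ∈ G.edgeSet ∧ ∀ x ∈ e, x ∈ S} ⊆
      {e | e ∈ G.edgeSet ∧ ∀ x ∈ e, x ∈ S.erase v} ∪
        ((S.filter (G.Adj v)).image fun u => s(v, u) : Finset (Sym2 V)) := by
    rintro e ⟨he, heS⟩
    by_cases hv : v ∈ e
    · right
      obtain ⟨u, rfl⟩ := Sym2.mem_iff_exists.mp hv
      simp only [Finset.coe_image, Set.mem_image, Finset.mem_coe, Finset.mem_filter]
      exact ⟨u, ⟨heS u (by simp), he⟩, rfl⟩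
    · left
      exact ⟨he, fun x hx => Finset.mem_erase.mpr ⟨fun h => hv (h ▸ hx), heS x hx⟩⟩
  refine (Set.ncard_le_ncard hsub).trans ((Set.ncard_union_le _ _).trans ?_)
  refine Nat.add_le_add_left ?_ _
  rw [Set.ncard_coe_finset]
  exact Finset.card_image_le

theorem edgesIn_le_choose [Fintype V] (S : Finset V) : edgesIn G S ≤ S.card.choose 2 := by
  classical
  induction S using Finset.induction with
  | empty =>
    simp only [edgesIn, Finset.card_empty, Finset.notMem_empty]
    refine le_of_eq ((Set.ncard_eq_zero (Set.toFinite _)).2 (Set.eq_empty_of_forall_notMem ?_))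
    rintro e ⟨-, he⟩
    induction e with
    | _ x y => exact he x (by simp)
  | insert v S hv ih =>
    have h := edgesIn_le_erase (G := G) (insert v S) v
    rw [Finset.erase_insert hv] at h
    have h2 : ((insert v S).filter (G.Adj v)).card ≤ S.card := by
      refine Finset.card_le_card fun x hx => ?_
      rw [Finset.mem_filter, Finset.mem_insert] at hx
      exact hx.1.resolve_left fun h => hx.2.ne h.symm
    have h3 := Nat.choose_succ_succ' S.card 1
    rw [Nat.choose_one_right] at h3
    rw [Finset.card_insert_of_notMem hv]
    exact h.trans ((Nat.add_le_add ih h2).trans (by rw [h3, add_comm]))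

/-- Every graph has a largest vertex set inducing a subgraph of minimum degree at least `q`. -/
theorem exists_core [Fintype V] [DecidableEq V] (G : SimpleGraph V) [DecidableRel G.Adj] (q : ℕ) :
    ∃ H : Finset V, (∀ v ∈ H, q ≤ (H.filter (G.Adj v)).card) ∧
      ∀ S : Finset V, (∀ v ∈ S, q ≤ (S.filter (G.Adj v)).card) → S ⊆ H := by
  refine ⟨(Finset.univ.filter fun S : Finset V => ∀ v ∈ S, q ≤ (S.filter (G.Adj v)).card).sup id,
    fun v hv => ?_, fun S hS => Finset.le_sup (f := id) (by simpa using hS)⟩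
  obtain ⟨S, hS, hvS⟩ := Finset.mem_sup.mp hv
  refine ((Finset.mem_filter.mp hS).2 v hvS).trans (Finset.card_le_card ?_)
  exact Finset.filter_subset_filter _ (Finset.le_sup (f := id) hS)

/-- A vertex set not contained in the `(q + 1)`-core has a vertex of small degree outside it. -/
theorem exists_degree_le_of_not_subset [DecidableRel G.Adj] {q : ℕ} {H : Finset V}
    (hH : ∀ v ∈ H, q + 1 ≤ (H.filter (G.Adj v)).card)
    (hmax : ∀ S : Finset V, (∀ v ∈ S, q + 1 ≤ (S.filter (G.Adj v)).card) → S ⊆ H)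
    {S : Finset V} (hHS : H ⊂ S) : ∃ v ∈ S, v ∉ H ∧ (S.filter (G.Adj v)).card ≤ q := by
  by_contra! hcon
  refine hHS.2 (hmax S fun v hv => ?_)
  by_cases hvH : v ∈ H
  · exact (hH v hvH).trans (Finset.card_le_card (Finset.filter_subset_filter _ hHS.1))
  · exact hcon v hv hvH

/-- Disintegration: outside the `(q + 1)`-core of a supergraph each vertex accounts for at most `q`
edges. -/
theorem edgesIn_le_of_core [Fintype V] {G' : SimpleGraph V} (hle : G ≤ G')
    [DecidableRel G'.Adj] {q : ℕ} {H : Finset V}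
    (hH : ∀ v ∈ H, q + 1 ≤ (H.filter (G'.Adj v)).card)
    (hmax : ∀ S : Finset V, (∀ v ∈ S, q + 1 ≤ (S.filter (G'.Adj v)).card) → S ⊆ H)
    {c m : ℕ} (hc : ∀ S : Finset V, H ⊆ S → S.card = m → edgesIn G S ≤ c)
    (hm : H.card ≤ m) {S : Finset V} (hS : H ⊆ S) (hmS : m ≤ S.card) :
    edgesIn G S ≤ c + q * (S.card - m) := by
  classical
  induction hn : S.card - m generalizing S with
  | zero => simpa using hc S hS (by omega)
  | succ n ih =>
    obtain ⟨v, hv, hvH, hdeg⟩ := exists_degree_le_of_not_subset hH hmax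
      (Finset.ssubset_iff_subset_ne.mpr ⟨hS, fun h => by subst h; omega⟩)
    have hcard := Finset.card_erase_of_mem hv
    have h1 := ih (Finset.subset_erase.mpr ⟨hS, hvH⟩) (by omega) (by omega)
    have h2 : (S.filter (G.Adj v)).card ≤ (S.filter (G'.Adj v)).card :=
      Finset.card_le_card (Finset.monotone_filter_right _ fun u _ hu => hle hu)
    have h3 := edgesIn_le_erase (G := G) S v
    rw [mul_add]
    omega

end Cores

section UpperBound

variable {V : Type*} [DecidableEq V] {G : SimpleGraph V}

theorem PathOn.mono {G' : SimpleGraph V} (hle : G ≤ G') {u v : V} {S : Finset V}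
    (h : PathOn G u v S) : PathOn G' u v S := by
  obtain ⟨p, hp, rfl⟩ := h
  exact ⟨p.mapLe hle, hp.mapLe hle, by simp⟩

theorem TwoConnected.exists_pathOn (hG : TwoConnected G) {w x y : V} (hx : x ≠ w) (hy : y ≠ w) :
    ∃ I, PathOn G x y I ∧ w ∉ I := by
  obtain ⟨p⟩ := (hG.2 w).preconnected ⟨x, Set.mem_univ x, hx⟩ ⟨y, Set.mem_univ y, hy⟩
  let q : G.Walk x y := p.map (Subgraph.hom _)
  refine ⟨_, ⟨q.bypass, q.bypass_isPath, rfl⟩, fun hw => ?_⟩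
  have hw : w ∈ q.support := q.support_bypass_subset_support (by simpa using hw)
  obtain ⟨z, -, hz⟩ := List.mem_map.mp ((p.support_map (Subgraph.hom _)) ▸ hw)
  exact z.2.2 hz

theorem PathOn.exists_adj_start {u v : V} {S : Finset V} (h : PathOn G u v S) (huv : u ≠ v) :
    ∃ w ∈ S, G.Adj u w := by
  obtain ⟨p, hp, rfl⟩ := h
  cases p with
  | nil => exact absurd rfl huv
  | cons hadj p => exact ⟨_, by simp, hadj⟩

theorem two_le_degree_of_pathOn [Fintype V] [DecidableRel G.Adj] (hV : 3 ≤ Fintype.card V)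
    (hconn : ∀ w x y, x ≠ w → y ≠ w → ∃ I, PathOn G x y I ∧ w ∉ I) (v : V) :
    2 ≤ (Finset.univ.filter (G.Adj v)).card := by
  have hex : ∀ w, w ≠ v → ∃ u, G.Adj v u ∧ u ≠ w := by
    intro w hw
    obtain ⟨y, hy⟩ : ∃ y, y ∉ ({v, w} : Finset V) := by
      by_contra! hcon
      have := Finset.card_le_card (fun y _ => hcon y : Finset.univ ⊆ ({v, w} : Finset V))
      have := Finset.card_le_two (a := v) (b := w)
      rw [Finset.card_univ] at *
      omega
    simp only [Finset.mem_insert, Finset.mem_singleton, not_or] at hy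
    obtain ⟨I, hI, hwI⟩ := hconn w v y hw.symm hy.2
    obtain ⟨u, hu, hvu⟩ := hI.exists_adj_start (Ne.symm hy.1)
    exact ⟨u, hvu, fun h => hwI (h ▸ hu)⟩
  obtain ⟨w, hw⟩ := Fintype.exists_ne_of_one_lt_card (by omega) v
  obtain ⟨u, hu, -⟩ := hex w hw
  obtain ⟨u', hu', hne⟩ := hex u hu.ne'
  exact Finset.one_lt_card.mpr ⟨u, by simpa using hu, u', by simpa using hu', hne.symm⟩

theorem exists_pathOn_of_isClique {S : Finset V} (hS : G.IsClique S) (hne : S.Nonempty) :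
    ∃ u ∈ S, ∃ v ∈ S, PathOn G u v S := by
  induction hne using Finset.Nonempty.cons_induction with
  | singleton a => exact ⟨a, by simp, a, by simp, .refl a⟩
  | cons a S ha _ ih =>
    rw [Finset.coe_cons] at hS
    obtain ⟨u, hu, v, hv, h⟩ := ih (hS.subset (Set.subset_insert _ _))
    have hau : G.Adj a u := hS (by simp) (by simp [hu]) fun h => ha (h ▸ hu)
    refine ⟨a, by simp, v, by simp [hv], ?_⟩
    have := (PathOn.of_adj hau).append h (by
      intro x hx hxS
      rw [Finset.mem_insert, Finset.mem_singleton] at hx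
      exact hx.resolve_left fun h => ha (h ▸ hxS))
    convert this using 1
    ext x
    simp only [Finset.mem_cons, Finset.mem_union, Finset.mem_insert, Finset.mem_singleton]
    grind

theorem exists_isCycle_of_isClique {S : Finset V} (hS : G.IsClique S) (hc : 3 ≤ S.card) :
    ∃ (x : V) (C : G.Walk x x), C.IsCycle ∧ C.length = S.card := by
  obtain ⟨u, hu, v, hv, h⟩ := exists_pathOn_of_isClique hS (Finset.card_pos.mp (by omega))
  refine exists_isCycle_of_pathOn_adj h (hS hu hv ?_) hc
  rintro rfl
  obtain ⟨p, hp, rfl⟩ := h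
  have := Walk.length_support p
  rw [List.toFinset_card_of_nodup hp.support_nodup, this,
    Walk.length_eq_zero_iff.mpr (Walk.isPath_iff_nil.mp hp)] at hc
  omega

theorem card_filter_adj_of_isClique [DecidableRel G.Adj] {S : Finset V} (hS : G.IsClique S)
    {v : V} (hv : v ∈ S) : (S.filter (G.Adj v)).card = S.card - 1 := by
  rw [← Finset.card_erase_of_mem hv]
  congr 1
  ext u
  rw [Finset.mem_filter, Finset.mem_erase]
  exact ⟨fun h => ⟨h.2.ne', h.1⟩, fun h => ⟨h.2, hS hv h.2 h.1.symm⟩⟩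

/-- If `k ≤ 2 * t + 2`, the nonempty `(t + 1)`-core `H` of a saturated graph is a clique, and it is
also the `(k - |H| + 1)`-core. -/
theorem core_eq_of_saturated [Fintype V] [DecidableRel G.Adj] {k t : ℕ} (hk : 3 ≤ k)
    (hG : ∀ (v : V) (C : G.Walk v v), C.IsCycle → C.length < k)
    (hsat : ∀ u v, u ≠ v → ¬ G.Adj u v → ∃ p : G.Walk u v, p.IsPath ∧ k ≤ p.length + 1)
    (hconn : ∀ w x y, x ≠ w → y ≠ w → ∃ I, PathOn G x y I ∧ w ∉ I)
    (ht : k ≤ 2 * t + 2) (ht' : 1 ≤ t) {H : Finset V} (hne : H.Nonempty)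
    (hH : ∀ v ∈ H, t + 1 ≤ (H.filter (G.Adj v)).card)
    (hHmax : ∀ S : Finset V, (∀ v ∈ S, t + 1 ≤ (S.filter (G.Adj v)).card) → S ⊆ H) :
    t + 2 ≤ H.card ∧ H.card < k ∧
      ∀ S : Finset V, (∀ v ∈ S, k - H.card + 1 ≤ (S.filter (G.Adj v)).card) → S ⊆ H := by
  have hcl : G.IsClique H := fun x hx y hy hxy =>
    adj_of_degree_sum hk hG hsat hconn (by omega) hH hH (fun x hx _ _ _ _ => hx)
      (fun x hx _ _ _ _ => hx) x hx y hy hxy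
  obtain ⟨v, hv⟩ := hne
  have h1 := hH v hv
  rw [card_filter_adj_of_isClique hcl hv] at h1
  have hlt : H.card < k := by
    obtain ⟨x, C, hC, hl⟩ := exists_isCycle_of_isClique hcl (by omega)
    exact hl ▸ hG x C hC
  refine ⟨by omega, hlt, ?_⟩
  obtain ⟨K, hK, hKmax⟩ := exists_core G (k - H.card + 1)
  refine fun S hS => (hKmax S hS).trans ?_
  have hHK : H ⊆ K := hKmax H fun u hu => by
    have := hH u hu
    omega
  intro x hx
  by_contra hxH
  have hadj := adj_of_degree_sum (X := K \ H) (Y := H) (X' := K) (Y' := H) (d₂ := H.card - 1)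
    hk hG hsat hconn (by omega)
    (fun u hu => hK u (Finset.mem_sdiff.mp hu).1)
    (fun u hu => (card_filter_adj_of_isClique hcl hu).ge)
    (fun u hu y hy huy hna => Finset.mem_sdiff.mpr ⟨hu, fun huH => hna (hcl huH hy huy)⟩)
    (fun y hy _ _ _ _ => hy) x (Finset.mem_sdiff.mpr ⟨hx, hxH⟩)
  have hcl' : G.IsClique (insert x H : Finset V) := by
    rw [Finset.coe_insert]
    exact hcl.insert fun y hy hxy => hadj y hy hxy
  refine hxH (hHmax (insert x H) (fun u hu => ?_) (Finset.mem_insert_self x H))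
  rw [card_filter_adj_of_isClique hcl' hu, Finset.card_insert_of_notMem hxH]
  omega

/-- The edge bound coming from disintegration of a saturated supergraph. -/
theorem ncard_edgeSet_le [Fintype V] {k t r : ℕ} (hk : 5 ≤ k) (hkV : k ≤ Fintype.card V)
    (ht : k ≤ 2 * t + 2) (ht' : 2 * t + 1 ≤ k) (hG2 : TwoConnected G) (hr : G.CliqueFree r)
    (hG : ∀ (v : V) (C : G.Walk v v), C.IsCycle → C.length < k) :
    G.edgeSet.ncard ≤ t.choose 2 + t * (Fintype.card V - t) ∨
      ∃ a, 2 ≤ a ∧ a ≤ t ∧ G.edgeSet.ncard ≤ exK (k - a) r + a * (Fintype.card V - (k - a)) := by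
  classical
  obtain ⟨G', hle, hG', hsat⟩ := exists_saturated hG
  have hconn : ∀ w x y, x ≠ w → y ≠ w → ∃ I, PathOn G' x y I ∧ w ∉ I := fun w x y hx hy =>
    let ⟨I, hI, hw⟩ := hG2.exists_pathOn hx hy
    ⟨I, hI.mono hle, hw⟩
  rw [← edgesIn_univ, ← Finset.card_univ]
  have hcard := Finset.card_univ (α := V)
  obtain ⟨H, hH, hHmax⟩ := exists_core G' (t + 1)
  rcases H.eq_empty_or_nonempty with rfl | hne
  · left
    exact edgesIn_le_of_core hle hH hHmax (fun S _ hS => hS ▸ edgesIn_le_choose S)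
      (by simp) (Finset.empty_subset _) (by omega)
  · right
    obtain ⟨h1, h2, h3⟩ := core_eq_of_saturated (by omega) hG' hsat hconn ht (by omega) hne hH hHmax
    have h4 : H.card + 2 ≤ k := by
      by_contra! hlt
      have := Finset.card_le_card (h3 Finset.univ fun v _ => by
        have := two_le_degree_of_pathOn (by omega) hconn v
        omega)
      omega
    refine ⟨k - H.card, by omega, by omega, ?_⟩
    rw [Nat.sub_sub_self h2.le]
    refine edgesIn_le_of_core hle (fun v hv => ?_) h3 (fun S hS hSH => ?_) le_rfl
      (Finset.subset_univ _) (Finset.card_le_univ _)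
    · have := hH v hv
      omega
    · rw [Finset.eq_of_subset_of_card_le hS hSH.le]
      exact edgesIn_le_exK hr _

end UpperBound

section TuranNumber

theorem exK_eq_turanGraph (m : ℕ) {s : ℕ} (hs : 0 < s) :
    exK m (s + 1) = (turanGraph m s).edgeFinset.card := by
  refine le_antisymm (csSup_le ⟨_, _, turanGraph_cliqueFree hs, rfl⟩ ?_) ?_
  · classical
    rintro e ⟨G, hG, rfl⟩
    rw [← coe_edgeFinset, Set.ncard_coe_finset]
    exact (isTuranMaximal_turanGraph hs).2 hG
  · rw [← Set.ncard_coe_finset, coe_edgeFinset]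
    exact le_exK (turanGraph_cliqueFree hs)

theorem exK_of_le {m s : ℕ} (hs : 0 < s) (hm : m ≤ s) : exK m (s + 1) = m.choose 2 := by
  rw [exK_eq_turanGraph m hs]
  have := card_edgeFinset_top_eq_card_choose_two (V := Fin m)
  rw [Fintype.card_fin] at this
  rw [← this]
  congr!
  exact turanGraph_eq_top.mpr (.inr hm)

theorem add_choose_two (j s : ℕ) : (j + s).choose 2 = j.choose 2 + j * s + s.choose 2 := by
  induction s with
  | zero => simp
  | succ s ih =>
    rw [← add_assoc, Nat.choose_succ_succ' (j + s) 1, Nat.choose_succ_succ' s 1,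
      Nat.choose_one_right, Nat.choose_one_right, ih]
    ring

theorem exK_add_of_le {j s : ℕ} (hs : 0 < s) (hj : j ≤ s) :
    exK (j + s) (s + 1) + j = (j + s).choose 2 := by
  rw [exK_eq_turanGraph _ hs, card_edgeFinset_turanGraph_add, ← exK_eq_turanGraph _ hs,
    exK_of_le hs hj, add_choose_two]
  obtain ⟨s, rfl⟩ := Nat.exists_eq_add_one.mpr hs
  rw [Nat.add_sub_cancel]
  ring

theorem two_mul_exK_le {m s : ℕ} (hs : 0 < s) (hm : m + 2 ≤ 2 * s) :
    2 * exK (m + 1) (s + 1) ≤ exK m (s + 1) + exK (m + 2) (s + 1) := by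
  have h1 : (m + 1).choose 2 = m.choose 2 + m := by
    rw [Nat.choose_succ_succ' m 1, Nat.choose_one_right, add_comm]
  have h2 : (m + 2).choose 2 = (m + 1).choose 2 + (m + 1) := by
    rw [Nat.choose_succ_succ' (m + 1) 1, Nat.choose_one_right, add_comm]
  have key : ∀ l ≤ 2 * s, exK l (s + 1) + (l - s) = l.choose 2 := by
    intro l hl
    rcases le_total l s with h | h
    · rw [exK_of_le hs h, Nat.sub_eq_zero_of_le h, add_zero]
    · obtain ⟨j, rfl⟩ := Nat.exists_eq_add_of_le' h
      rw [Nat.add_sub_cancel, exK_add_of_le hs (by omega)]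
  have k1 := key m (by omega)
  have k2 := key (m + 1) (by omega)
  have k3 := key (m + 2) hm
  omega

theorem le_max_of_convex {f : ℕ → ℕ} {l h : ℕ}
    (hf : ∀ a, l ≤ a → a + 2 ≤ h → 2 * f (a + 1) ≤ f a + f (a + 2)) {a : ℕ}
    (hla : l ≤ a) (hah : a ≤ h) : f a ≤ max (f l) (f h) := by
  induction h generalizing a with
  | zero => simp [Nat.le_zero.mp hah]
  | succ h ih =>
    have ih' := fun {b : ℕ} => ih (fun a h1 h2 => hf a h1 (by omega)) (a := b)
    rcases hah.eq_or_lt with rfl | hlt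
    · exact le_max_right _ _
    · have h1 := ih' hla (by omega)
      rcases (show l ≤ h by omega).eq_or_lt with rfl | hlh
      · exact h1.trans (by simp)
      · obtain ⟨b, rfl⟩ := Nat.exists_eq_add_of_lt hlh
        have h2 := ih' (b := l + b) (by omega) (by omega)
        have h3 : 2 * f (l + b + 1) ≤ f (l + b) + f (l + b + 1 + 1) :=
          hf (l + b) (by omega) (by omega)
        omega

/-- Among the numbers of edges of the extremal graphs, the extreme values of `a` dominate. -/
theorem edges_le_max {n k t s a : ℕ} (hkn : k ≤ n) (hkt : k ≤ 2 * t + 2) (hts : t < s)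
    (ha : 2 ≤ a) (hat : a ≤ t) (htk : t ≤ k) :
    exK (k - a) (s + 1) + a * (n - (k - a)) ≤
      max (2 * (n - k + 2) + exK (k - 2) (s + 1)) (t * (n - k + t) + exK (k - t) (s + 1)) := by
  have h := le_max_of_convex (f := fun a => a * (n - k + a) + exK (k - a) (s + 1)) (l := 2)
    (h := t) (fun b hb hbt => ?_) ha hat
  · rwa [show n - (k - a) = n - k + a by omega, add_comm]
  · obtain ⟨m, rfl⟩ := Nat.exists_eq_add_of_le' (show b + 2 ≤ k by omega)
    have h1 := two_mul_exK_le (m := m) (s := s) (by omega) (by omega)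
    have e1 : m + (b + 2) - b = m + 2 := by omega
    have e2 : m + (b + 2) - (b + 1) = m + 1 := by omega
    have e3 : m + (b + 2) - (b + 2) = m := by omega
    simp only [e1, e2, e3]
    nlinarith

theorem choose_two_add_le {n k t s : ℕ} (hkn : k ≤ n) (hkt : k ≤ 2 * t + 2) (htk : 2 * t + 1 ≤ k)
    (hts : t < s) :
    t.choose 2 + t * (n - t) ≤ t * (n - k + t) + exK (k - t) (s + 1) := by
  have h1 : (t + 1).choose 2 = t.choose 2 + t := by
    rw [Nat.choose_succ_succ' t 1, Nat.choose_one_right, add_comm]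
  have h2 : (t + 2).choose 2 = (t + 1).choose 2 + (t + 1) := by
    rw [Nat.choose_succ_succ' (t + 1) 1, Nat.choose_one_right, add_comm]
  obtain ⟨p, rfl⟩ := Nat.exists_eq_add_of_le hkn
  rw [show k + p - k + t = p + t by omega]
  rcases (show k = 2 * t + 1 ∨ k = 2 * t + 2 by omega) with rfl | rfl
  · rw [show 2 * t + 1 - t = t + 1 by omega, exK_of_le (by omega) hts,
      show 2 * t + 1 + p - t = p + t + 1 by omega, h1]
    linarith
  · rw [show 2 * t + 2 - t = t + 2 by omega, show 2 * t + 2 + p - t = p + t + 2 by omega]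
    have h3 : (t + 2).choose 2 ≤ exK (t + 2) (s + 1) + 1 := by
      rcases (show t + 2 ≤ s ∨ s = t + 1 by omega) with h | rfl
      · exact (exK_of_le (by omega) h).ge.trans (Nat.le_succ _)
      · have := exK_add_of_le (j := 1) (s := t + 1) (by omega) (by omega)
        rw [show 1 + (t + 1) = t + 2 by omega] at this
        exact this.ge
    linarith

end TuranNumber

section Construction

/-- The Turán graph `T(M, s)` with `n - M` further vertices joined to its first `a` vertices. -/
def extremalGraph (n M a s : ℕ) : SimpleGraph (Fin n) where
  Adj i j := i ≠ j ∧ ((i.val < M ∧ j.val < M ∧ i.val % s ≠ j.val % s) ∨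
    (i.val < a ∧ M ≤ j.val) ∨ (j.val < a ∧ M ≤ i.val))
  symm.symm i j h := ⟨h.1.symm, by
    rcases h.2 with ⟨h1, h2, h3⟩ | h | h
    · exact .inl ⟨h2, h1, h3.symm⟩
    · exact .inr (.inr h)
    · exact .inr (.inl h)⟩
  loopless.irrefl i h := h.1 rfl

variable {n M a s : ℕ}

theorem extremalGraph_cliqueFree (haM : a ≤ M) (has : a < s) :
    (extremalGraph n M a s).CliqueFree (s + 1) := by
  refine Colorable.cliqueFree ⟨Coloring.mk (fun i : Fin n =>
    if i.val < M then (⟨i.val % s, Nat.mod_lt _ (by omega)⟩ : Fin s) else ⟨a, has⟩) ?_⟩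
    (Nat.lt_succ_self s)
  intro i j h
  rcases h with ⟨-, ⟨h1, h2, h3⟩ | ⟨h1, h2⟩ | ⟨h1, h2⟩⟩
  · simpa [h1, h2] using h3
  · have := Nat.mod_eq_of_lt (h1.trans has)
    by_cases hM : i.val < M <;> simp [hM, h2.not_gt, this] <;> omega
  · have := Nat.mod_eq_of_lt (h1.trans has)
    by_cases hM : j.val < M <;> simp [hM, h2.not_gt, this] <;> omega

theorem le_ncard_edgeSet_extremalGraph (hs : 0 < s) (haM : a ≤ M) (hMn : M ≤ n) :
    exK M (s + 1) + a * (n - M) ≤ (extremalGraph n M a s).edgeSet.ncard := by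
  classical
  let T := (turanGraph M s).edgeFinset.image (Sym2.map (Fin.castLE hMn))
  let g : Fin a × Fin (n - M) → Sym2 (Fin n) := fun p =>
    s(⟨p.1, by omega⟩, ⟨M + p.2, by omega⟩)
  let U := Finset.univ.image g
  have hT : T.card = exK M (s + 1) := by
    rw [exK_eq_turanGraph M hs]
    exact Finset.card_image_of_injective _ (Sym2.map.injective (Fin.castLE_injective hMn))
  have hU : U.card = a * (n - M) := by
    rw [Finset.card_image_of_injective, Finset.card_univ, Fintype.card_prod, Fintype.card_fin,
      Fintype.card_fin]
    rintro ⟨i, j⟩ ⟨i', j'⟩ h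
    simp only [g, Sym2.eq_iff, Fin.mk.injEq] at h
    ext <;> dsimp only <;> omega
  have hTU : Disjoint T U := by
    rw [Finset.disjoint_left]
    intro e he he'
    obtain ⟨e, -, rfl⟩ := Finset.mem_image.mp he
    obtain ⟨⟨i, j⟩, -, h⟩ := Finset.mem_image.mp he'
    induction e with
    | _ x y =>
      simp only [g, Sym2.map_mk, Sym2.eq_iff, Fin.ext_iff, Fin.val_castLE] at h
      omega
  rw [← hT, ← hU, ← Finset.card_union_of_disjoint hTU, ← Set.ncard_coe_finset]
  refine Set.ncard_le_ncard fun e he => ?_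
  rcases Finset.mem_union.mp he with he | he
  · obtain ⟨e, he', rfl⟩ := Finset.mem_image.mp he
    clear he
    induction e with
    | _ x y =>
      have hadj : (turanGraph M s).Adj x y := by simpa using he'
      exact ⟨fun h => hadj.ne (Fin.castLE_injective hMn h), .inl ⟨x.2, y.2, hadj⟩⟩
  · obtain ⟨⟨i, j⟩, -, rfl⟩ := Finset.mem_image.mp he
    refine ⟨fun h => ?_, .inr (.inl ⟨i.2, Nat.le_add_right _ _⟩)⟩
    rw [Fin.ext_iff] at h
    dsimp only at h
    omega

theorem twoConnected_of_forall_exists {V : Type*} {G : SimpleGraph V} (hV : 3 ≤ Nat.card V)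
    (h : ∀ w, ∃ b ≠ w, ∀ x ≠ w, x ≠ b → G.Adj b x ∨ ∃ z ≠ w, G.Adj b z ∧ G.Adj z x) :
    TwoConnected G := by
  refine ⟨hV, fun w => ?_⟩
  obtain ⟨b, hb, hx⟩ := h w
  have hreach : ∀ x y (hx : x ≠ w) (hy : y ≠ w), G.Adj x y →
      ((⊤ : G.Subgraph).deleteVerts {w}).coe.Reachable ⟨x, Set.mem_univ x, hx⟩
        ⟨y, Set.mem_univ y, hy⟩ := by
    intro x y hx hy hxy
    refine Adj.reachable ?_
    rw [Subgraph.coe_adj, Subgraph.deleteVerts_adj]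
    exact ⟨Set.mem_univ x, hx, Set.mem_univ y, hy, hxy⟩
  rw [connected_iff_exists_forall_reachable]
  refine ⟨⟨b, Set.mem_univ b, hb⟩, ?_⟩
  rintro ⟨x, -, hxw⟩
  by_cases hxb : x = b
  · subst hxb
    rfl
  · rcases hx x hxw hxb with h | ⟨z, hz, hbz, hzx⟩
    · exact hreach b x hb hxw h
    · exact (hreach b z hb hz hbz).trans (hreach z x hz hxw hzx)

theorem extremalGraph_twoConnected (ha : 2 ≤ a) (haM : a < M) (has : a < s) (hMn : M ≤ n) :
    TwoConnected (extremalGraph n M a s) := by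
  refine twoConnected_of_forall_exists (by rw [Nat.card_fin]; omega) fun w => ?_
  obtain ⟨b, hb2, hbw⟩ : ∃ b < 2, b ≠ w.val := ⟨if w.val = 0 then 1 else 0, by grind, by grind⟩
  refine ⟨⟨b, by omega⟩, by rwa [Ne, Fin.ext_iff], fun x hx hxb => ?_⟩
  have hbs : b % s = b := Nat.mod_eq_of_lt (by omega)
  by_cases hxM : M ≤ x.val
  · exact .inl ⟨hxb.symm, .inr (.inl ⟨by dsimp only; omega, hxM⟩)⟩
  by_cases hxs : x.val % s = b
  · right
    obtain ⟨z, hz3, hzb, hzw⟩ : ∃ z < 3, z ≠ b ∧ z ≠ w.val :=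
      ⟨if b ≠ 0 ∧ w.val ≠ 0 then 0 else if b ≠ 1 ∧ w.val ≠ 1 then 1 else 2, by grind, by grind,
        by grind⟩
    have hzs : z % s = z := Nat.mod_eq_of_lt (by omega)
    refine ⟨⟨z, by omega⟩, by rwa [Ne, Fin.ext_iff], ⟨?_, .inl ⟨?_, ?_, ?_⟩⟩,
      ⟨?_, .inl ⟨?_, ?_, ?_⟩⟩⟩ <;> grind
  · refine .inl ⟨hxb.symm, .inl ⟨?_, ?_, ?_⟩⟩ <;> grind

theorem card_filter_lt_le {f : ℕ → Fin n} {L : ℕ} (hf : ∀ i j, f i = f j ↔ i % L = j % L)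
    (c m : ℕ) : ((Finset.range L).filter fun i => (f (i + c)).val < m).card ≤ m := by
  conv_rhs => rw [← Finset.card_range m]
  refine Finset.card_le_card_of_injOn (fun i => (f (i + c)).val) (fun i hi => ?_) ?_
  · have := (Finset.mem_filter.mp hi).2
    simpa using this
  · intro i hi j hj hij
    have hi := Finset.mem_range.mp (Finset.mem_filter.mp hi).1
    have hj := Finset.mem_range.mp (Finset.mem_filter.mp hj).1
    exact Nat.ModEq.eq_of_lt_of_lt (Nat.ModEq.add_right_cancel' c ((hf _ _).mp (Fin.ext hij))) hi hj

/-- A cycle of length at least `M + a` visits at least `a` added vertices, each followed by one of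
the `a` hubs, so it cannot leave the Turán part once it has left the hubs. -/
theorem extremalGraph_length_lt (ha : 1 ≤ a) (haM : a < M) {v : Fin n}
    {C : (extremalGraph n M a s).Walk v v} (hC : C.IsCycle) : C.length < M + a := by
  by_contra! hk
  obtain ⟨f, hadj, hf⟩ := hC.exists_periodic
  generalize C.length = L at hk hf
  let I := (Finset.range L).filter fun i => M ≤ (f i).val
  let J := (Finset.range L).filter fun i => (f (i + 1)).val < a
  have hIJ : I ⊆ J := by
    intro i hi
    obtain ⟨hi, hiM⟩ := Finset.mem_filter.mp hi
    have := (hadj i).2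
    exact Finset.mem_filter.mpr ⟨hi, by omega⟩
  have hJ : J.card ≤ a := card_filter_lt_le hf 1 a
  have hI : L ≤ I.card + M := by
    have h1 := Finset.card_filter_add_card_filter_not (s := Finset.range L)
      (fun i => M ≤ (f i).val)
    have h2 := card_filter_lt_le hf 0 M
    simp only [not_le, Finset.card_range] at h1
    simp only [add_zero] at h2
    change I.card + _ = L at h1
    omega
  have hIJ' : I = J := Finset.eq_of_subset_of_card_le hIJ (by omega)
  have hmod : ∀ i, f (i % L) = f i := fun i => (hf _ _).mpr (Nat.mod_mod _ _)
  have hstep : ∀ i, a ≤ (f i).val → (f i).val < M →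
      a ≤ (f (i + 1)).val ∧ (f (i + 1)).val < M := by
    intro i h1 h2
    have h3 : ¬ (f (i + 1)).val < a := fun h => by
      have hmem : i % L ∈ J := Finset.mem_filter.mpr
        ⟨Finset.mem_range.mpr (Nat.mod_lt _ (by omega)), by
          rwa [(hf (i % L + 1) (i + 1)).mpr (Nat.mod_add_mod _ _ _)]⟩
      rw [← hIJ'] at hmem
      have := (Finset.mem_filter.mp hmem).2
      rw [hmod] at this
      omega
    have := (hadj i).2
    omega
  obtain ⟨i₀, h1, h2⟩ : ∃ i, a ≤ (f i).val ∧ (f i).val < M := by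
    by_contra! hcon
    have h1 := card_filter_lt_le hf 0 a
    have h2 : Finset.range L ⊆ (Finset.range L).filter (fun i => (f (i + 0)).val < a) ∪ I := by
      intro i hi
      rw [Finset.mem_union, Finset.mem_filter, Finset.mem_filter]
      by_cases h : (f i).val < a
      · exact .inl ⟨hi, h⟩
      · exact .inr ⟨hi, hcon i (by omega)⟩
    have h3 := (Finset.card_le_card h2).trans (Finset.card_union_le _ _)
    have h4 := Finset.card_le_card hIJ
    rw [Finset.card_range] at h3
    omega
  have hall : ∀ j, a ≤ (f (i₀ + j)).val ∧ (f (i₀ + j)).val < M := by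
    intro j
    induction j with
    | zero => exact ⟨h1, h2⟩
    | succ j ih => exact hstep _ ih.1 ih.2
  obtain ⟨j, hj⟩ : I.Nonempty := Finset.card_pos.mp (by omega)
  have hjM := (Finset.mem_filter.mp hj).2
  have h3 := hall (j + i₀ * (L - 1))
  rw [show i₀ + (j + i₀ * (L - 1)) = j + L * i₀ by
    obtain ⟨l, rfl⟩ := Nat.exists_eq_add_of_le' (show 1 ≤ L by omega)
    rw [Nat.add_sub_cancel]
    ring, (hf _ j).mpr (Nat.add_mul_mod_self_left _ _ _)] at h3
  omega

end Construction

theorem stmt_16 (n k r : ℕ) (hr1 : (k - 1) / 2 + 2 ≤ r) (hr2 : r < k)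
    (hk : 5 ≤ k) (hkn : k ≤ n) :
    IsGreatest {m | ∃ G : SimpleGraph (Fin n), TwoConnected G ∧ G.CliqueFree r ∧
        (∀ (v : Fin n) (C : G.Walk v v), C.IsCycle → C.length < k) ∧
        G.edgeSet.ncard = m}
      (max (2 * (n - k + 2) + exK (k - 2) r)
        ((k - 1) / 2 * (n - k + (k - 1) / 2) + exK (k - (k - 1) / 2) r)) := by
  obtain ⟨s, rfl⟩ := Nat.exists_eq_add_of_le' (show 1 ≤ r by omega)
  generalize ht : (k - 1) / 2 = t at *
  have hupper : ∀ G : SimpleGraph (Fin n), TwoConnected G → G.CliqueFree (s + 1) →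
      (∀ (v : Fin n) (C : G.Walk v v), C.IsCycle → C.length < k) → G.edgeSet.ncard ≤
        max (2 * (n - k + 2) + exK (k - 2) (s + 1)) (t * (n - k + t) + exK (k - t) (s + 1)) := by
    intro G hG2 hGr hG
    have hcard := Fintype.card_fin n
    rcases ncard_edgeSet_le (t := t) hk (by omega) (by omega) (by omega) hG2 hGr hG with
      h | ⟨a, ha, hat, h⟩ <;> rw [hcard] at h
    · exact h.trans ((choose_two_add_le hkn (by omega) (by omega) (by omega)).trans
        (le_max_right _ _))
    · exact h.trans (edges_le_max hkn (by omega) (by omega) ha hat (by omega))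
  have hlower : ∀ a, 2 ≤ a → a ≤ t →
      max (2 * (n - k + 2) + exK (k - 2) (s + 1)) (t * (n - k + t) + exK (k - t) (s + 1)) =
        a * (n - k + a) + exK (k - a) (s + 1) →
      ∃ G : SimpleGraph (Fin n), TwoConnected G ∧ G.CliqueFree (s + 1) ∧
        (∀ (v : Fin n) (C : G.Walk v v), C.IsCycle → C.length < k) ∧
        G.edgeSet.ncard =
          max (2 * (n - k + 2) + exK (k - 2) (s + 1)) (t * (n - k + t) + exK (k - t) (s + 1)) := by
    intro a ha hat hmax
    have h2 : TwoConnected (extremalGraph n (k - a) a s) :=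
      extremalGraph_twoConnected ha (by omega) (by omega) (by omega)
    have hr : (extremalGraph n (k - a) a s).CliqueFree (s + 1) :=
      extremalGraph_cliqueFree (by omega) (by omega)
    have hcyc : ∀ (v : Fin n) (C : (extremalGraph n (k - a) a s).Walk v v), C.IsCycle →
        C.length < k := fun v C hC =>
      (extremalGraph_length_lt (by omega) (by omega) hC).trans_eq (by omega)
    refine ⟨_, h2, hr, hcyc, (hupper _ h2 hr hcyc).antisymm ?_⟩
    rw [hmax, show n - k + a = n - (k - a) by omega, add_comm]
    exact le_ncard_edgeSet_extremalGraph (by omega) (by omega) (by omega)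
  refine ⟨?_, fun m => ?_⟩
  · rcases max_choice (2 * (n - k + 2) + exK (k - 2) (s + 1))
      (t * (n - k + t) + exK (k - t) (s + 1)) with h | h
    · exact hlower 2 le_rfl (by omega) h
    · exact hlower t (by omega) le_rfl h
  · rintro ⟨G, hG2, hGr, hG, rfl⟩
    exact hupper G hG2 hGr hG
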